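/- arXiv:math/0401148 — 2 statements merged into one kernel-verified Lean document; each statement's English description precedes it below -/
import Mathlib

section
/- Let I₀ be a finite open interval of ℝ and f ∈ C³(I₀) with 0 < inf_{x∈I₀} |f''(x)| ≤ sup_{x∈I₀} |f''(x)| < ∞. Let ψ be an approximating function with lim_{t→∞} ψ(t) = 0 and lim_{t→∞} t ψ(t) = ∞. Then for any interval I ⊆ I₀ there exist constants δ₀, C₁ > 0 such that for all sufficiently large Q: |⋃_{p/q ∈ A_Q(I)} ( B(p₁/q, C₁/(Q² ψ(Q))) ∩ I )| ≥ |I|/2, where A_Q(I) := {p/q ∈ ℚ² : δ₀ Q < q ≤ Q, p₁/q ∈ I, |f(p₁/q) − p₂/q| < ψ(Q)/Q}. -/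
open MeasureTheory Filter

/-- An approximating function: a decreasing function `ℝ₊ → ℝ₊` taking positive values. -/
def IsApproxFun (ψ : ℝ → ℝ) : Prop :=
  (∀ x y : ℝ, 0 < x → x ≤ y → ψ y ≤ ψ x) ∧ ∀ x : ℝ, 0 < x → 0 < ψ x

/-- The least `q ∈ ℕ` with `q • r ∈ ℤ²`, for a rational point `r ∈ ℚ²`:
the lcm of the denominators. -/
def den2 (r : ℚ × ℚ) : ℕ := Nat.lcm r.1.den r.2.den

/-- A covering inequality on an interval, with a constant coming from the Besicovitch theorem. -/
theorem exists_covering_const : ∃ N : ℕ, ∀ (α β : ℝ) (κ : ENNReal) (E : Set ℝ),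
    (∀ x ∈ E, ∃ r > 0, r ≤ β - α ∧
      volume (E ∩ Metric.ball x r) ≤ κ * volume (Metric.closedBall x r ∩ Set.Icc α β)) →
    volume E ≤ N * κ * volume (Set.Icc α β) := by
  obtain ⟨N, τ, hτ, hN⟩ := HasBesicovitchCovering.no_satelliteConfig (α := ℝ)
  refine ⟨N, fun α β κ E h => ?_⟩
  choose r hr0 hr1 hr2 using h
  let P : Besicovitch.BallPackage E ℝ :=
    { c := fun x => x
      r := fun x => r x x.2
      rpos := fun x => hr0 x x.2
      r_bound := β - α
      r_le := fun x => hr1 x x.2 }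
  obtain ⟨s, hs, hcov⟩ := Besicovitch.exist_disjoint_covering_families hτ hN P
  have hcount : ∀ i, (s i).Countable := fun i =>
    (hs i).countable_of_nonempty_interior fun x _ => by
      rw [interior_closedBall _ (P.rpos x).ne']
      exact Metric.nonempty_ball.2 (P.rpos x)
  have hE : E ⊆ ⋃ i, ⋃ j ∈ s i, E ∩ Metric.ball (P.c j) (P.r j) := by
    intro x hx
    have := hcov ⟨⟨x, hx⟩, rfl⟩
    simp only [Set.mem_iUnion] at this ⊢
    obtain ⟨i, j, hj, hxj⟩ := this
    exact ⟨i, j, hj, hx, hxj⟩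
  calc volume E ≤ ∑ i, volume (⋃ j ∈ s i, E ∩ Metric.ball (P.c j) (P.r j)) :=
        (measure_mono hE).trans (measure_iUnion_fintype_le _ _)
    _ ≤ ∑ _i : Fin N, κ * volume (Set.Icc α β) := by
        refine Finset.sum_le_sum fun i _ => ?_
        calc _ ≤ ∑' j : s i, volume (E ∩ Metric.ball (P.c j) (P.r j)) :=
              measure_biUnion_le _ (hcount i) _
          _ ≤ ∑' j : s i, κ * volume (Metric.closedBall (P.c j) (P.r j) ∩ Set.Icc α β) :=
              ENNReal.tsum_le_tsum fun j => hr2 _ j.1.2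
          _ = κ * volume (⋃ j ∈ s i, Metric.closedBall (P.c j) (P.r j) ∩ Set.Icc α β) := by
              rw [ENNReal.tsum_mul_left, measure_biUnion (hcount i)]
              · exact (hs i).mono fun j => Set.inter_subset_left
              · exact fun j _ => Metric.isClosed_closedBall.measurableSet.inter measurableSet_Icc
          _ ≤ κ * volume (Set.Icc α β) := by
              gcongr
              exact Set.iUnion₂_subset fun j _ => Set.inter_subset_right
    _ = N * κ * volume (Set.Icc α β) := by simp [mul_assoc]

/-- Among finitely many functions that are small at `x`, one stays small the longest: on the ball
where it does so, all functions of the family become large. -/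
theorem exists_extremal_ball {ι : Type*} {α β ρ x : ℝ} {φ : ι → ℝ → ℝ}
    (hcont : ∀ i, ContinuousOn (φ i) (Set.Icc α β))
    (hsup : ∀ i, ∃ y ∈ Set.Icc α β, ρ ≤ φ i y)
    (hx : x ∈ Set.Icc α β) (hfin : {i | φ i x < ρ}.Finite) (hne : ∃ i, φ i x < ρ) :
    ∃ i, ∃ r > 0, r ≤ β - α ∧ (∀ y ∈ Metric.ball x r ∩ Set.Icc α β, φ i y < ρ) ∧
      ∀ j, ∃ y ∈ Metric.closedBall x r ∩ Set.Icc α β, ρ ≤ φ j y := by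
  have hmin : ∀ i, ∃ y ∈ Set.Icc α β, ρ ≤ φ i y ∧
      ∀ z ∈ Set.Icc α β, ρ ≤ φ i z → dist y x ≤ dist z x := by
    intro i
    have hc : IsCompact (Set.Icc α β ∩ φ i ⁻¹' Set.Ici ρ) :=
      isCompact_Icc.of_isClosed_subset
        ((hcont i).preimage_isClosed_of_isClosed isClosed_Icc isClosed_Ici) Set.inter_subset_left
    obtain ⟨y, hy, hmin⟩ := hc.exists_isMinOn (by obtain ⟨y, hy, h⟩ := hsup i; exact ⟨y, hy, h⟩)
      (f := fun y => dist y x) (by fun_prop)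
    exact ⟨y, hy.1, hy.2, fun z hz h => hmin ⟨hz, h⟩⟩
  choose y hyJ hyρ hymin using hmin
  obtain ⟨i, hi, himax⟩ := hfin.toFinset.exists_max_image (fun i => dist (y i) x)
    (by obtain ⟨i, hi⟩ := hne; exact ⟨i, by simpa using hi⟩)
  simp only [Set.Finite.mem_toFinset, Set.mem_ofPred_eq] at hi himax
  refine ⟨i, dist (y i) x, dist_pos.2 ?_, ?_, ?_, ?_⟩
  · intro h
    exact absurd (hyρ i) (by rw [h]; exact not_le.2 hi)
  · have := hyJ i
    rw [Real.dist_eq, abs_le]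
    constructor <;> linarith [this.1, this.2, hx.1, hx.2]
  · rintro z ⟨hz, hzJ⟩
    by_contra! h
    exact absurd (hymin i z hzJ h) (not_le.2 hz)
  · intro j
    by_cases hj : φ j x < ρ
    · exact ⟨y j, ⟨himax j hj, hyJ j⟩, hyρ j⟩
    · exact ⟨x, ⟨Metric.mem_closedBall_self dist_nonneg, hx⟩, not_lt.1 hj⟩

/-- A two-step version of quantitative nondivergence, with a constant that is absolute. -/
theorem exists_nondivergence_const : ∃ N : ℕ, ∀ {ι : Type} {α β ρ ε : ℝ} {κ : ENNReal}
    {φ : ι → ℝ → ℝ} {R : ι → ι → Prop} {E : Set ℝ},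
    (∀ i, ContinuousOn (φ i) (Set.Icc α β)) →
    (∀ i, ∃ y ∈ Set.Icc α β, ρ ≤ φ i y) →
    (∀ x ∈ Set.Icc α β, {i | φ i x < ρ}.Finite) →
    (∀ i s t, Set.Icc s t ⊆ Set.Icc α β → (∃ y ∈ Set.Icc s t, ρ ≤ φ i y) →
      volume {x ∈ Set.Icc s t | φ i x < ε} ≤ κ * volume (Set.Icc s t)) →
    E ⊆ Set.Icc α β →
    (∀ x ∈ E, ∃ i, φ i x < ρ) →
    (∀ x ∈ E, ∀ i, ε ≤ φ i x → φ i x < ρ → ∃ j, R i j ∧ φ j x < ρ) →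
    (∀ x ∈ E, ∀ i j, R i j → ε ≤ φ i x → φ i x < ρ → ε ≤ φ j x → φ j x < ρ → False) →
    volume E ≤ N * κ * volume (Set.Icc α β) := by
  obtain ⟨N, hN⟩ := exists_covering_const
  refine ⟨N * (1 + N), fun {ι α β ρ ε κ φ R E} hcont hsup hfin hgood hE h0 h1 h2 => ?_⟩
  have hball : ∀ x r s t : ℝ, Metric.closedBall x r ∩ Set.Icc s t
      = Set.Icc (max (x - r) s) (min (x + r) t) := fun x r s t => by
    rw [Real.closedBall_eq_Icc, Set.Icc_inter_Icc]
  have key := hN α β ((1 + N) * κ) E fun x hx => by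
    obtain ⟨i, r, hr0, hr1, hri, hrj⟩ :=
      exists_extremal_ball hcont hsup (hE hx) (hfin x (hE hx)) (h0 x hx)
    refine ⟨r, hr0, hr1, ?_⟩
    have hsub : Metric.closedBall x r ∩ Set.Icc α β ⊆ Set.Icc α β := Set.inter_subset_right
    rw [hball] at hsub hrj ⊢
    set s := max (x - r) α
    set t := min (x + r) β
    have hst : Metric.ball x r ∩ Set.Icc α β ⊆ Set.Icc s t := by
      rw [← hball]
      exact Set.inter_subset_inter_left _ Metric.ball_subset_closedBall
    set E' := {y ∈ E ∩ Metric.ball x r | ε ≤ φ i y} with hE'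
    have hE'st : E' ⊆ Set.Icc s t := fun y hy => hst ⟨hy.1.2, hE hy.1.1⟩
    have key2 := hN s t κ E' fun y hy => by
      obtain ⟨⟨j, hj⟩, r', hr'0, hr'1, hr'i, hr'j⟩ :=
        exists_extremal_ball (ι := {j // R i j}) (φ := fun j => φ j) (α := s) (β := t) (x := y)
          (ρ := ρ) (fun j => (hcont j).mono hsub) (fun j => hrj j) (hE'st hy)
          ((hfin y (hE hy.1.1)).preimage Subtype.val_injective.injOn)
          (by
            obtain ⟨j, hj, hj'⟩ := h1 y hy.1.1 i hy.2 (hri y ⟨hy.1.2, hE hy.1.1⟩)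
            exact ⟨⟨j, hj⟩, hj'⟩)
      refine ⟨r', hr'0, hr'1, ?_⟩
      have hsub' : Metric.closedBall y r' ∩ Set.Icc s t ⊆ Set.Icc s t := Set.inter_subset_right
      have hg := hr'j ⟨j, hj⟩
      rw [hball] at hsub' hg ⊢
      refine le_trans (measure_mono ?_) (hgood j _ _ (hsub'.trans hsub) hg)
      rintro z ⟨hz, hzb⟩
      refine ⟨?_, ?_⟩
      · rw [← hball]
        exact ⟨Metric.ball_subset_closedBall hzb, hE'st hz⟩
      · by_contra! hzε
        exact h2 z hz.1.1 i j hj hz.2 (hri z ⟨hz.1.2, hE hz.1.1⟩) hzε (hr'i z ⟨hzb, hE'st hz⟩)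
    have hcover : E ∩ Metric.ball x r ⊆ {y ∈ Set.Icc s t | φ i y < ε} ∪ E' := by
      intro y hy
      by_cases h : φ i y < ε
      · exact Or.inl ⟨hst ⟨hy.2, hE hy.1⟩, h⟩
      · exact Or.inr ⟨hy, not_lt.1 h⟩
    calc volume (E ∩ Metric.ball x r)
        ≤ κ * volume (Set.Icc s t) + N * κ * volume (Set.Icc s t) :=
          (measure_mono hcover).trans ((measure_union_le _ _).trans
            (add_le_add (hgood i s t hsub (hrj i)) key2))
      _ = (1 + N) * κ * volume (Set.Icc s t) := by ring
  calc volume E ≤ _ := key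
    _ = _ := by push_cast; ring

theorem volume_le_of_sub_le {S : Set ℝ} {d : ℝ} (h : ∀ x ∈ S, ∀ y ∈ S, x < y → y - x ≤ d)
    (hd : 0 ≤ d) : volume S ≤ ENNReal.ofReal d := by
  refine (Real.volume_le_diam S).trans (Metric.ediam_le fun x hx y hy => ?_)
  rw [edist_dist, Real.dist_eq]
  refine ENNReal.ofReal_le_ofReal ?_
  rcases lt_trichotomy x y with hxy | rfl | hxy
  · rw [abs_sub_comm, abs_of_pos (sub_pos.2 hxy)]; exact h x hx y hy hxy
  · simpa
  · rw [abs_of_pos (sub_pos.2 hxy)]; exact h y hy x hx hxy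

/-- Sublevel estimate for a bi-Lipschitz function. -/
theorem volume_sublevel_le_of_biLipschitz {l : ℝ → ℝ} {s t m K S τ : ℝ} (hm : 0 ≤ m) (hK : 1 ≤ K)
    (hS : 0 < S) (hτ : 0 < τ)
    (hlow : ∀ x ∈ Set.Icc s t, ∀ y ∈ Set.Icc s t, m * |x - y| ≤ |l x - l y|)
    (hup : ∀ x ∈ Set.Icc s t, ∀ y ∈ Set.Icc s t, |l x - l y| ≤ K * m * |x - y|)
    (hy : ∃ y ∈ Set.Icc s t, S ≤ |l y|) :
    volume {x ∈ Set.Icc s t | |l x| < τ * S} ≤ ENNReal.ofReal (4 * K * τ * (t - s)) := by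
  obtain ⟨y, hy, hyS⟩ := hy
  have hst : 0 ≤ t - s := by linarith [hy.1, hy.2]
  by_cases hτ2 : 1 / 2 < τ
  · calc _ ≤ volume (Set.Icc s t) := measure_mono (Set.sep_subset _ _)
      _ = ENNReal.ofReal (t - s) := Real.volume_Icc
      _ ≤ _ := ENNReal.ofReal_le_ofReal (by
        have : 1 ≤ 4 * K * τ := by nlinarith
        nlinarith)
  · refine volume_le_of_sub_le ?_ (by positivity)
    rintro x ⟨hx, hxl⟩ z ⟨hz, hzl⟩ hxz
    have h1 : S / 2 ≤ K * m * (t - s) := by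
      have h2 := hup y hy x hx
      have h3 : |y - x| ≤ t - s := by
        rw [abs_le]; constructor <;> linarith [hy.1, hy.2, hx.1, hx.2]
      have h4 := abs_sub_abs_le_abs_sub (l y) (l x)
      have h5 : K * m * |y - x| ≤ K * m * (t - s) := by gcongr
      nlinarith
    have hm' : 0 < m := by
      rcases hm.eq_or_lt with h | h
      · rw [← h] at h1; simp at h1; linarith
      · exact h
    have h2 := hlow z hz x hx
    rw [abs_of_pos (sub_pos.2 hxz)] at h2
    have h3 := abs_sub (l z) (l x)
    have h4 : m * (z - x) ≤ m * (4 * K * τ * (t - s)) := by nlinarith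
    exact le_of_mul_le_mul_left h4 hm'

/-- Sublevel estimate for a function whose derivative is comparable to a monotone
bi-Lipschitz function. -/
theorem volume_sublevel_le_of_hasDerivAt {h l k : ℝ → ℝ} {s t m K ρ τ d₁ d₂ : ℝ} (hm : 0 ≤ m)
    (hK : 1 ≤ K) (hρ : 0 < ρ) (hτ : 0 < τ)
    (hlow : ∀ x ∈ Set.Icc s t, ∀ y ∈ Set.Icc s t, m * |x - y| ≤ |l x - l y|)
    (hup : ∀ x ∈ Set.Icc s t, ∀ y ∈ Set.Icc s t, |l x - l y| ≤ K * m * |x - y|)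
    (hmono : MonotoneOn l (Set.Icc s t) ∨ AntitoneOn l (Set.Icc s t))
    (hd₁ : 0 < d₁) (hd₂ : d₂ ≤ K * d₁)
    (hk : ∀ x ∈ Set.Icc s t, d₁ ≤ |k x| ∧ |k x| ≤ d₂)
    (hderiv : ∀ x ∈ Set.Icc s t, HasDerivAt h (l x * k x) x)
    (hy : ∃ y ∈ Set.Icc s t, ρ ≤ |h y|) :
    volume {x ∈ Set.Icc s t | |h x| < τ ^ 2 * ρ} ≤ ENNReal.ofReal (12 * K * τ * (t - s)) := by
  obtain ⟨y, hy, hyρ⟩ := hy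
  have hst : 0 ≤ t - s := by linarith [hy.1, hy.2]
  have hd₂0 : 0 < d₂ := lt_of_lt_of_le hd₁ ((hk y hy).1.trans (hk y hy).2)
  have hmvt : ∀ u ∈ Set.Icc s t, ∀ v ∈ Set.Icc s t, u < v →
      ∃ ξ ∈ Set.Ioo u v, h v - h u = l ξ * k ξ * (v - u) := by
    intro u hu v hv huv
    have hsub : Set.Icc u v ⊆ Set.Icc s t := Set.Icc_subset_Icc hu.1 hv.2
    obtain ⟨ξ, hξ, e⟩ := exists_hasDerivAt_eq_slope h (fun x => l x * k x) huv
      (fun x hx => (hderiv x (hsub hx)).continuousAt.continuousWithinAt)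
      (fun x hx => hderiv x (hsub (Set.Ioo_subset_Icc_self hx)))
    refine ⟨ξ, hξ, ?_⟩
    rw [e, div_mul_cancel₀ _ (sub_pos.2 huv).ne']
  by_cases hτ2 : 1 / 2 < τ
  · calc _ ≤ volume (Set.Icc s t) := measure_mono (Set.sep_subset _ _)
      _ = ENNReal.ofReal (t - s) := Real.volume_Icc
      _ ≤ _ := ENNReal.ofReal_le_ofReal (by
        have : 1 ≤ 12 * K * τ := by nlinarith
        nlinarith)
  rcases Set.eq_empty_or_nonempty {x ∈ Set.Icc s t | |h x| < τ ^ 2 * ρ} with he | ⟨z, hz, hzρ⟩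
  · rw [he]; simp
  have hosc : ρ / 2 ≤ |h y - h z| := by
    have h1 := abs_sub_abs_le_abs_sub (h y) (h z)
    have h2 : τ ^ 2 ≤ 1 / 2 := by nlinarith
    nlinarith
  have hξ : ∃ ξ ∈ Set.Icc s t, ρ / 2 ≤ |l ξ| * d₂ * (t - s) := by
    have aux : ∀ u ∈ Set.Icc s t, ∀ v ∈ Set.Icc s t, u < v → ρ / 2 ≤ |h v - h u| →
        ∃ ξ ∈ Set.Icc s t, ρ / 2 ≤ |l ξ| * d₂ * (t - s) := by
      intro u hu v hv huv hh
      obtain ⟨ξ, hξ, e⟩ := hmvt u hu v hv huv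
      have hξ' : ξ ∈ Set.Icc s t := ⟨hu.1.trans hξ.1.le, hξ.2.le.trans hv.2⟩
      refine ⟨ξ, hξ', hh.trans ?_⟩
      rw [e, abs_mul, abs_mul, abs_of_pos (sub_pos.2 huv)]
      have := (hk ξ hξ').2
      have h2 : v - u ≤ t - s := by linarith [hu.1, hv.2]
      have h3 : 0 ≤ v - u := by linarith
      gcongr
    rcases lt_trichotomy y z with hyz | rfl | hyz
    · exact aux y hy z hz hyz (by rwa [abs_sub_comm])
    · simp at hosc; linarith
    · exact aux z hz y hy hyz hosc
  obtain ⟨ξ, hξ, hlξ⟩ := hξ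
  have hst' : 0 < t - s := by
    rcases hst.eq_or_lt with e | e
    · rw [← e] at hlξ; simp at hlξ; linarith
    · exact e
  set S := ρ / (2 * d₂ * (t - s)) with hSdef
  have hS : 0 < S := by positivity
  have hlS : S ≤ |l ξ| := by
    rw [hSdef, div_le_iff₀ (by positivity)]; linarith
  have hρS : ρ = 2 * d₂ * (t - s) * S := by rw [hSdef]; field_simp
  have hA := volume_sublevel_le_of_biLipschitz hm hK hS hτ hlow hup ⟨ξ, hξ, hlS⟩
  have hB : ∀ P : ℝ → Prop, (∀ u ∈ Set.Icc s t, ∀ v ∈ Set.Icc s t, ∀ w ∈ Set.Ioo u v,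
      P (l u) → P (l v) → τ * S ≤ |l w|) →
      volume {x ∈ Set.Icc s t | P (l x) ∧ |h x| < τ ^ 2 * ρ}
        ≤ ENNReal.ofReal (4 * K * τ * (t - s)) := by
    intro P hP
    refine volume_le_of_sub_le ?_ (by positivity)
    rintro u ⟨hu, hPu, hhu⟩ v ⟨hv, hPv, hhv⟩ huv
    obtain ⟨w, hw, e⟩ := hmvt u hu v hv huv
    have h1 : |h v - h u| = |l w| * |k w| * (v - u) := by
      rw [e, abs_mul, abs_mul, abs_of_pos (sub_pos.2 huv)]
    have h2 : τ * S * d₁ * (v - u) ≤ |h v - h u| := by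
      rw [h1]
      have h3 := hP u hu v hv w hw hPu hPv
      have h4 := (hk w ⟨hu.1.trans hw.1.le, hw.2.le.trans hv.2⟩).1
      have h5 : 0 ≤ v - u := by linarith
      gcongr
    have h3 : |h v - h u| ≤ 2 * τ ^ 2 * ρ := by linarith [abs_sub (h v) (h u)]
    have h4 : 2 * τ ^ 2 * ρ ≤ τ * S * d₁ * (4 * K * τ * (t - s)) := by
      rw [hρS]
      have : 0 ≤ τ ^ 2 * (t - s) * S := by positivity
      nlinarith
    exact le_of_mul_le_mul_left ((h2.trans h3).trans h4) (by positivity)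
  have hB1 := hB (fun z => τ * S ≤ z) (by
    intro u hu v hv w hw hPu hPv
    have hw' : w ∈ Set.Icc s t := ⟨hu.1.trans hw.1.le, hw.2.le.trans hv.2⟩
    refine le_trans ?_ (le_abs_self _)
    rcases hmono with hl | hl
    · exact hPu.trans (hl hu hw' hw.1.le)
    · exact hPv.trans (hl hw' hv hw.2.le))
  have hB2 := hB (fun z => z ≤ -(τ * S)) (by
    intro u hu v hv w hw hPu hPv
    have hw' : w ∈ Set.Icc s t := ⟨hu.1.trans hw.1.le, hw.2.le.trans hv.2⟩
    refine le_trans ?_ (neg_le_abs _)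
    rw [le_neg]
    rcases hmono with hl | hl
    · exact (hl hw' hv hw.2.le).trans hPv
    · exact (hl hu hw' hw.1.le).trans hPu)
  have hcover : {x ∈ Set.Icc s t | |h x| < τ ^ 2 * ρ} ⊆ {x ∈ Set.Icc s t | |l x| < τ * S} ∪
      ({x ∈ Set.Icc s t | τ * S ≤ l x ∧ |h x| < τ ^ 2 * ρ} ∪
        {x ∈ Set.Icc s t | l x ≤ -(τ * S) ∧ |h x| < τ ^ 2 * ρ}) := by
    rintro x ⟨hx, hhx⟩
    by_cases hl : |l x| < τ * S
    · exact Or.inl ⟨hx, hl⟩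
    · rcases le_abs.1 (not_lt.1 hl) with hl | hl
      · exact Or.inr (Or.inl ⟨hx, hl, hhx⟩)
      · exact Or.inr (Or.inr ⟨hx, le_neg.1 hl, hhx⟩)
  calc _ ≤ _ := measure_mono hcover
    _ ≤ _ := (measure_union_le _ _).trans (add_le_add hA ((measure_union_le _ _).trans
      (add_le_add hB1 hB2)))
    _ = _ := by
      rw [← ENNReal.ofReal_add (by positivity) (by positivity),
        ← ENNReal.ofReal_add (by positivity) (by positivity)]
      congr 1; ring

/-- An integer vector is primitive if it takes the value `1` under some integer linear form. -/
def IsPrimitiveVector (v : Fin 3 → ℤ) : Prop := ∃ u : Fin 3 → ℤ, dotProduct u v = 1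

theorem exists_isPrimitiveVector_smul {v : Fin 3 → ℤ} (hv : v ≠ 0) :
    ∃ (k : ℤ) (w : Fin 3 → ℤ), k ≠ 0 ∧ IsPrimitiveVector w ∧ v = k • w := by
  have hne : ∃ i, v i ≠ 0 := by
    by_contra! h
    exact hv (funext h)
  obtain ⟨i, hi⟩ := hne
  obtain ⟨w, hw, hw1⟩ := Finset.extract_gcd v (s := Finset.univ) ⟨i, Finset.mem_univ i⟩
  refine ⟨Finset.univ.gcd v, w, ?_, ?_, funext fun j => by simpa using hw j (Finset.mem_univ j)⟩
  · intro h
    exact hi (Finset.gcd_eq_zero_iff.1 h i (Finset.mem_univ i))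
  · obtain ⟨u, hu⟩ := Finset.gcd_eq_sum_mul Finset.univ w
    exact ⟨u, by rw [dotProduct_comm, dotProduct, ← hu, hw1]⟩

theorem IsPrimitiveVector.exists_eq_smul {v w : Fin 3 → ℤ} (hv : IsPrimitiveVector v)
    (h : crossProduct w v = 0) : ∃ k : ℤ, w = k • v := by
  obtain ⟨u, hu⟩ := hv
  refine ⟨dotProduct u w, ?_⟩
  rw [cross_apply] at h
  have h0 := congrFun h 0
  have h1 := congrFun h 1
  have h2 := congrFun h 2
  simp only [Matrix.vec3_dotProduct] at hu
  simp only [Matrix.cons_val, Pi.zero_apply] at h0 h1 h2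
  ext i
  simp only [Matrix.vec3_dotProduct, Pi.smul_apply, smul_eq_mul]
  fin_cases i <;> simp only [Fin.zero_eta, Fin.mk_one, Fin.reduceFinMk]
  · linear_combination (-w 0) * hu + u 1 * h2 - u 2 * h1
  · linear_combination (-w 1) * hu - u 0 * h2 + u 2 * h0
  · linear_combination (-w 2) * hu + u 0 * h1 - u 1 * h0

theorem IsPrimitiveVector.ne_zero {v : Fin 3 → ℤ} (hv : IsPrimitiveVector v) : v ≠ 0 := by
  rintro rfl
  obtain ⟨u, hu⟩ := hv
  simp at hu

theorem finite_of_abs_le {S : Set (Fin 3 → ℤ)} (R : ℝ) (h : ∀ v ∈ S, ∀ i, |(v i : ℝ)| ≤ R) :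
    S.Finite := by
  refine (Set.finite_Icc (fun _ : Fin 3 => -⌈R⌉) (fun _ => ⌈R⌉)).subset fun v hv => ?_
  have hR : ∀ i, -⌈R⌉ ≤ v i ∧ v i ≤ ⌈R⌉ := fun i => by
    rw [← abs_le]
    have := (h v hv i).trans (Int.le_ceil R)
    exact_mod_cast this
  exact ⟨fun i => (hR i).1, fun i => (hR i).2⟩

/-- The size of an integer vector in the lattice attached to the point `x` of the curve
`y = f x` with tangent slope `g x`. -/
noncomputable def primalNorm (f g : ℝ → ℝ) (T₁ T₂ T₃ : ℝ) (v : Fin 3 → ℤ) (x : ℝ) : ℝ :=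
  max (|(v 0 : ℝ)| / T₁) (max (|(v 1 - v 0 * x : ℝ)| / T₂)
    (|(v 2 - v 0 * f x - (v 1 - v 0 * x) * g x : ℝ)| / T₃))

/-- The size of an integer vector in the lattice dual to the one used in `primalNorm`. -/
noncomputable def dualNorm (f g : ℝ → ℝ) (T₁ T₂ T₃ : ℝ) (a : Fin 3 → ℤ) (x : ℝ) : ℝ :=
  max (|(a 0 + a 1 * x + a 2 * f x : ℝ)| * T₁) (max (|(a 1 + a 2 * g x : ℝ)| * T₂)
    (|(a 2 : ℝ)| * T₃))

section Norms

variable {f g : ℝ → ℝ} {T₁ T₂ T₃ : ℝ} {x : ℝ}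

theorem primalNorm_le_iff (h₁ : 0 < T₁) (h₂ : 0 < T₂) (h₃ : 0 < T₃) {v : Fin 3 → ℤ} {c : ℝ} :
    primalNorm f g T₁ T₂ T₃ v x ≤ c ↔ |(v 0 : ℝ)| ≤ c * T₁ ∧ |(v 1 - v 0 * x : ℝ)| ≤ c * T₂ ∧
      |(v 2 - v 0 * f x - (v 1 - v 0 * x) * g x : ℝ)| ≤ c * T₃ := by
  rw [primalNorm, max_le_iff, max_le_iff, div_le_iff₀ h₁, div_le_iff₀ h₂, div_le_iff₀ h₃]

theorem primalNorm_lt_iff (h₁ : 0 < T₁) (h₂ : 0 < T₂) (h₃ : 0 < T₃) {v : Fin 3 → ℤ} {c : ℝ} :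
    primalNorm f g T₁ T₂ T₃ v x < c ↔ |(v 0 : ℝ)| < c * T₁ ∧ |(v 1 - v 0 * x : ℝ)| < c * T₂ ∧
      |(v 2 - v 0 * f x - (v 1 - v 0 * x) * g x : ℝ)| < c * T₃ := by
  rw [primalNorm, max_lt_iff, max_lt_iff, div_lt_iff₀ h₁, div_lt_iff₀ h₂, div_lt_iff₀ h₃]

theorem primalNorm_smul (k : ℤ) (v : Fin 3 → ℤ) :
    primalNorm f g T₁ T₂ T₃ (k • v) x = |(k : ℝ)| * primalNorm f g T₁ T₂ T₃ v x := by
  simp only [primalNorm, Pi.smul_apply, smul_eq_mul, Int.cast_mul]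
  rw [mul_max_of_nonneg _ _ (abs_nonneg _), mul_max_of_nonneg _ _ (abs_nonneg _),
    ← mul_div_assoc, ← mul_div_assoc, ← mul_div_assoc, ← abs_mul, ← abs_mul, ← abs_mul]
  ring_nf

theorem dualNorm_smul (k : ℤ) (a : Fin 3 → ℤ) :
    dualNorm f g T₁ T₂ T₃ (k • a) x = |(k : ℝ)| * dualNorm f g T₁ T₂ T₃ a x := by
  simp only [dualNorm, Pi.smul_apply, smul_eq_mul, Int.cast_mul]
  rw [mul_max_of_nonneg _ _ (abs_nonneg _), mul_max_of_nonneg _ _ (abs_nonneg _),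
    ← mul_assoc, ← mul_assoc, ← mul_assoc, ← abs_mul, ← abs_mul, ← abs_mul]
  ring_nf

theorem primalNorm_nonneg (h₁ : 0 < T₁) (v : Fin 3 → ℤ) : 0 ≤ primalNorm f g T₁ T₂ T₃ v x :=
  (div_nonneg (abs_nonneg _) h₁.le).trans (le_max_left _ _)

theorem dualNorm_nonneg (h₁ : 0 < T₁) (a : Fin 3 → ℤ) : 0 ≤ dualNorm f g T₁ T₂ T₃ a x :=
  (mul_nonneg (abs_nonneg _) h₁.le).trans (le_max_left _ _)

theorem le_abs_intCast_mul {k : ℤ} (hk : k ≠ 0) {c : ℝ} (hc : 0 ≤ c) : c ≤ |(k : ℝ)| * c := by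
  have : (1 : ℝ) ≤ |(k : ℝ)| := by exact_mod_cast Int.one_le_abs hk
  nlinarith

theorem primalNorm_le_smul (h₁ : 0 < T₁) {k : ℤ} (hk : k ≠ 0) (v : Fin 3 → ℤ) :
    primalNorm f g T₁ T₂ T₃ v x ≤ primalNorm f g T₁ T₂ T₃ (k • v) x := by
  rw [primalNorm_smul]
  exact le_abs_intCast_mul hk (primalNorm_nonneg h₁ v)

theorem dualNorm_le_smul (h₁ : 0 < T₁) {k : ℤ} (hk : k ≠ 0) (a : Fin 3 → ℤ) :
    dualNorm f g T₁ T₂ T₃ a x ≤ dualNorm f g T₁ T₂ T₃ (k • a) x := by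
  rw [dualNorm_smul]
  exact le_abs_intCast_mul hk (dualNorm_nonneg h₁ a)

theorem abs_dotProduct_le (h₁ : 0 < T₁) (h₂ : 0 < T₂) (h₃ : 0 < T₃) (a v : Fin 3 → ℤ) :
    |((dotProduct a v : ℤ) : ℝ)| ≤
      3 * (dualNorm f g T₁ T₂ T₃ a x * primalNorm f g T₁ T₂ T₃ v x) := by
  obtain ⟨hv1, hv2, hv3⟩ :=
    (primalNorm_le_iff (f := f) (g := g) (x := x) (v := v) h₁ h₂ h₃).1 le_rfl
  have ha := le_refl (dualNorm f g T₁ T₂ T₃ a x)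
  have hn := dualNorm_nonneg (f := f) (g := g) (T₂ := T₂) (T₃ := T₃) (x := x) h₁ a
  set n := primalNorm f g T₁ T₂ T₃ v x
  set d := dualNorm f g T₁ T₂ T₃ a x
  conv at ha => lhs; simp only [d]
  rw [dualNorm, max_le_iff, max_le_iff] at ha
  obtain ⟨ha1, ha2, ha3⟩ := ha
  have e : ((dotProduct a v : ℤ) : ℝ) = (a 0 + a 1 * x + a 2 * f x) * v 0 +
      (a 1 + a 2 * g x) * (v 1 - v 0 * x) +
      a 2 * (v 2 - v 0 * f x - (v 1 - v 0 * x) * g x) := by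
    rw [Matrix.vec3_dotProduct]; push_cast; ring
  have aux : ∀ {A B T : ℝ}, 0 < T → |A| * T ≤ d → |B| ≤ n * T → |A * B| ≤ d * n := by
    intro A B T hT hA hB
    rw [abs_mul]
    have hA' : |A| ≤ d / T := by rwa [le_div_iff₀ hT]
    calc |A| * |B| ≤ (d / T) * (n * T) := by gcongr
      _ = d * n := by field_simp
  rw [e]
  refine (abs_add_three _ _ _).trans ?_
  linarith [aux h₁ ha1 hv1, aux h₂ ha2 hv2, aux h₃ ha3 hv3]

theorem dualNorm_crossProduct_le (h₁ : 0 < T₁) (h₂ : 0 < T₂) (h₃ : 0 < T₃)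
    (hT : T₁ * T₂ * T₃ = 1) (v w : Fin 3 → ℤ) :
    dualNorm f g T₁ T₂ T₃ (crossProduct v w) x ≤
      2 * (primalNorm f g T₁ T₂ T₃ v x * primalNorm f g T₁ T₂ T₃ w x) := by
  obtain ⟨hv1, hv2, hv3⟩ :=
    (primalNorm_le_iff (f := f) (g := g) (x := x) (v := v) h₁ h₂ h₃).1 le_rfl
  obtain ⟨hw1, hw2, hw3⟩ :=
    (primalNorm_le_iff (f := f) (g := g) (x := x) (v := w) h₁ h₂ h₃).1 le_rfl
  set n := primalNorm f g T₁ T₂ T₃ v x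
  set d := primalNorm f g T₁ T₂ T₃ w x
  have aux : ∀ {A B A' B' S T U : ℝ}, 0 < S → 0 < T → 0 < U → S * T * U = 1 →
      |A| ≤ n * S → |B| ≤ n * T → |A'| ≤ d * S → |B'| ≤ d * T →
      |A * B' - B * A'| * U ≤ 2 * (n * d) := by
    intro A B A' B' S T U hS hT hU h hA hB hA' hB'
    have h1 : |A| * |B'| ≤ (n * S) * (d * T) := by
      gcongr; exact (abs_nonneg _).trans hA
    have h2 : |B| * |A'| ≤ (n * T) * (d * S) := by
      gcongr; exact (abs_nonneg _).trans hB
    have h3 : |A * B' - B * A'| ≤ 2 * (n * d) * (S * T) := by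
      have := abs_sub (A * B') (B * A')
      rw [abs_mul, abs_mul] at this
      linarith
    calc _ ≤ 2 * (n * d) * (S * T) * U := by gcongr
      _ = 2 * (n * d) * (S * T * U) := by ring
      _ = _ := by rw [h, mul_one]
  rw [dualNorm, max_le_iff, max_le_iff]
  simp only [cross_apply, Matrix.cons_val, Int.cast_sub, Int.cast_mul]
  refine ⟨?_, ?_, ?_⟩
  · refine le_trans (le_of_eq ?_) (aux h₂ h₃ h₁ (by linarith) hv2 hv3 hw2 hw3)
    congr 2; ring
  · refine le_trans (le_of_eq ?_) (aux h₃ h₁ h₂ (by linarith) hv3 hv1 hw3 hw1)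
    congr 2; ring
  · refine le_trans (le_of_eq ?_) (aux h₁ h₂ h₃ hT hv1 hv2 hw1 hw2)
    congr 2; ring

theorem finite_primalNorm_lt (h₁ : 0 < T₁) (h₂ : 0 < T₂) (h₃ : 0 < T₃) (c : ℝ) :
    {v : Fin 3 → ℤ | primalNorm f g T₁ T₂ T₃ v x < c}.Finite := by
  refine finite_of_abs_le (c * T₁ + (c * T₂ + c * T₁ * |x|) +
    (c * T₃ + c * T₁ * |f x| + c * T₂ * |g x|)) fun v hv => ?_
  obtain ⟨h1, h2, h3⟩ := (primalNorm_lt_iff h₁ h₂ h₃).1 hv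
  have b1 : |(v 0 : ℝ) * x| ≤ c * T₁ * |x| := by rw [abs_mul]; gcongr
  have b2 : |(v 0 : ℝ) * f x| ≤ c * T₁ * |f x| := by rw [abs_mul]; gcongr
  have b3 : |((v 1 : ℝ) - v 0 * x) * g x| ≤ c * T₂ * |g x| := by rw [abs_mul]; gcongr
  have a1 : |(v 1 : ℝ)| ≤ c * T₂ + c * T₁ * |x| := by
    have := abs_add_le ((v 1 : ℝ) - v 0 * x) (v 0 * x)
    rw [sub_add_cancel] at this; linarith
  have a2 : |(v 2 : ℝ)| ≤ c * T₃ + c * T₁ * |f x| + c * T₂ * |g x| := by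
    have := abs_add_three ((v 2 : ℝ) - v 0 * f x - (v 1 - v 0 * x) * g x) (v 0 * f x)
      ((v 1 - v 0 * x) * g x)
    rw [show (v 2 : ℝ) - v 0 * f x - (v 1 - v 0 * x) * g x + v 0 * f x + (v 1 - v 0 * x) * g x
      = v 2 by ring] at this
    linarith
  have p0 := abs_nonneg (v 0 : ℝ)
  have p1 := abs_nonneg (v 1 : ℝ)
  have p2 := abs_nonneg (v 2 : ℝ)
  intro i
  fin_cases i <;> simp only [Fin.zero_eta, Fin.mk_one, Fin.reduceFinMk] <;> linarith

theorem finite_dualNorm_lt (h₁ : 0 < T₁) (h₂ : 0 < T₂) (h₃ : 0 < T₃) (c : ℝ) :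
    {a : Fin 3 → ℤ | dualNorm f g T₁ T₂ T₃ a x < c}.Finite := by
  refine finite_of_abs_le (c / T₃ + (c / T₂ + c / T₃ * |g x|) +
    (c / T₁ + (c / T₂ + c / T₃ * |g x|) * |x| + c / T₃ * |f x|)) fun v hv => ?_
  simp only [Set.mem_ofPred_eq, dualNorm, max_lt_iff, ← lt_div_iff₀ h₁, ← lt_div_iff₀ h₂,
    ← lt_div_iff₀ h₃] at hv
  obtain ⟨h1, h2, h3⟩ := hv
  have b1 : |(v 2 : ℝ) * g x| ≤ c / T₃ * |g x| := by rw [abs_mul]; gcongr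
  have b2 : |(v 2 : ℝ) * f x| ≤ c / T₃ * |f x| := by rw [abs_mul]; gcongr
  have a1 : |(v 1 : ℝ)| ≤ c / T₂ + c / T₃ * |g x| := by
    have := abs_sub ((v 1 : ℝ) + v 2 * g x) (v 2 * g x)
    rw [add_sub_cancel_right] at this; linarith
  have b3 : |(v 1 : ℝ) * x| ≤ (c / T₂ + c / T₃ * |g x|) * |x| := by rw [abs_mul]; gcongr
  have a2 : |(v 0 : ℝ)| ≤ c / T₁ + (c / T₂ + c / T₃ * |g x|) * |x| + c / T₃ * |f x| := by
    have := abs_add_three ((v 0 : ℝ) + v 1 * x + v 2 * f x) (-(v 1 * x)) (-(v 2 * f x))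
    rw [show (v 0 : ℝ) + v 1 * x + v 2 * f x + -(v 1 * x) + -(v 2 * f x) = v 0 by ring,
      abs_neg, abs_neg] at this
    linarith
  have p0 := abs_nonneg (v 0 : ℝ)
  have p1 := abs_nonneg (v 1 : ℝ)
  have p2 := abs_nonneg (v 2 : ℝ)
  intro i
  fin_cases i <;> simp only [Fin.zero_eta, Fin.mk_one, Fin.reduceFinMk] <;> linarith

end Norms

/-- `f` has derivative `g` and second derivative `k` on `J`, and the curvature of its graph is
pinched between `c` and `K * c`. -/
structure IsCurvedOn (f g k : ℝ → ℝ) (c K : ℝ) (J : Set ℝ) : Prop where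
  pos : 0 < c
  one_le : 1 ≤ K
  hasDerivAt : ∀ x ∈ J, HasDerivAt f (g x) x
  hasDerivAt' : ∀ x ∈ J, HasDerivAt g (k x) x
  bound : ∀ x ∈ J, c ≤ |k x| ∧ |k x| ≤ K * c
  mono : MonotoneOn g J ∨ AntitoneOn g J

namespace IsCurvedOn

variable {f g k : ℝ → ℝ} {c K : ℝ} {J J' : Set ℝ}

theorem subset (h : IsCurvedOn f g k c K J) (hJ : J' ⊆ J) : IsCurvedOn f g k c K J' :=
  ⟨h.pos, h.one_le, fun x hx => h.hasDerivAt x (hJ hx), fun x hx => h.hasDerivAt' x (hJ hx),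
    fun x hx => h.bound x (hJ hx), h.mono.imp (fun m => m.mono hJ) fun m => m.mono hJ⟩

theorem continuousOn (h : IsCurvedOn f g k c K J) : ContinuousOn f J :=
  fun x hx => (h.hasDerivAt x hx).continuousAt.continuousWithinAt

theorem continuousOn' (h : IsCurvedOn f g k c K J) : ContinuousOn g J :=
  fun x hx => (h.hasDerivAt' x hx).continuousAt.continuousWithinAt

theorem abs_sub_bounds (h : IsCurvedOn f g k c K J) (hJ : J.OrdConnected) {x y : ℝ}
    (hx : x ∈ J) (hy : y ∈ J) : c * |x - y| ≤ |g x - g y| ∧ |g x - g y| ≤ K * c * |x - y| := by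
  have aux : ∀ u ∈ J, ∀ v ∈ J, u < v →
      c * |u - v| ≤ |g u - g v| ∧ |g u - g v| ≤ K * c * |u - v| := by
    intro u hu v hv huv
    have hsub : Set.Icc u v ⊆ J := hJ.out hu hv
    obtain ⟨ξ, hξ, e⟩ := exists_hasDerivAt_eq_slope g k huv
      (fun x hx => (h.hasDerivAt' x (hsub hx)).continuousAt.continuousWithinAt)
      (fun x hx => h.hasDerivAt' x (hsub (Set.Ioo_subset_Icc_self hx)))
    have e' : |g u - g v| = |k ξ| * |u - v| := by
      rw [e, abs_div, abs_sub_comm (g v), abs_sub_comm v, div_mul_cancel₀]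
      exact (abs_pos.2 (sub_ne_zero.2 huv.ne)).ne'
    obtain ⟨h1, h2⟩ := h.bound ξ (hsub (Set.Ioo_subset_Icc_self hξ))
    rw [e']
    constructor <;> gcongr
  rcases lt_trichotomy x y with hxy | rfl | hxy
  · exact aux x hx y hy hxy
  · simp
  · rw [abs_sub_comm x, abs_sub_comm (g x)]
    exact aux y hy x hx hxy

variable {T₁ T₂ T₃ : ℝ} {s t ρ τ : ℝ}

theorem volume_primalNorm_lt_le (h : IsCurvedOn f g k c K (Set.Icc s t)) (h₁ : 0 < T₁)
    (h₂ : 0 < T₂) (h₃ : 0 < T₃) (hρ : 0 < ρ) (hτ : 0 < τ) (hτ1 : τ ≤ 1) (v : Fin 3 → ℤ)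
    (hy : ∃ y ∈ Set.Icc s t, ρ ≤ primalNorm f g T₁ T₂ T₃ v y) :
    volume {x ∈ Set.Icc s t | primalNorm f g T₁ T₂ T₃ v x < τ ^ 2 * ρ} ≤
      ENNReal.ofReal (12 * K * τ * (t - s)) := by
  have hK := h.one_le
  have hst : 0 ≤ t - s := by
    obtain ⟨y, hy, -⟩ := hy
    linarith [hy.1, hy.2]
  simp only [primalNorm_lt_iff h₁ h₂ h₃]
  simp only [primalNorm, le_max_iff, le_div_iff₀ h₁, le_div_iff₀ h₂, le_div_iff₀ h₃] at hy
  obtain ⟨y, hyI, hy | hy | hy⟩ := hy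
  · refine le_of_eq_of_le ?_ zero_le
    convert measure_empty (μ := volume)
    refine Set.eq_empty_of_forall_notMem fun x hx => ?_
    have : τ ^ 2 * ρ * T₁ ≤ 1 * ρ * T₁ := by gcongr; nlinarith
    linarith [hx.2.1]
  · refine (measure_mono ?_).trans ((volume_sublevel_le_of_biLipschitz (m := |(v 0 : ℝ)|)
      (l := fun x => v 1 - v 0 * x) (τ := τ ^ 2) (S := ρ * T₂) (abs_nonneg _) hK (by positivity)
      (by positivity) (fun x _ y _ => ?_) (fun x _ y _ => ?_) ⟨y, hyI, hy⟩).trans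
      (ENNReal.ofReal_le_ofReal ?_))
    · rintro x ⟨hx, -, h2, -⟩
      exact ⟨hx, by simpa [mul_assoc] using h2⟩
    · rw [← abs_mul, abs_sub_comm]
      exact le_of_eq (by ring_nf)
    · rw [mul_assoc, ← abs_mul, abs_sub_comm]
      refine le_trans (le_of_eq (by ring_nf)) (le_mul_of_one_le_left (abs_nonneg _) hK)
    · have : τ ^ 2 ≤ 3 * τ := by nlinarith
      calc 4 * K * τ ^ 2 * (t - s) ≤ 4 * K * (3 * τ) * (t - s) := by gcongr
        _ = _ := by ring
  · refine (measure_mono ?_).trans (volume_sublevel_le_of_hasDerivAt (m := |(v 0 : ℝ)|)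
      (h := fun x => v 2 - v 0 * f x - (v 1 - v 0 * x) * g x)
      (l := fun x => v 0 * x - v 1) (k := k) (τ := τ) (ρ := ρ * T₃) (d₁ := c) (d₂ := K * c)
      (abs_nonneg _) hK (by positivity)
      hτ (fun x _ y _ => ?_) (fun x _ y _ => ?_) ?_ h.pos le_rfl h.bound (fun x hx => ?_)
      ⟨y, hyI, hy⟩)
    · rintro x ⟨hx, -, -, h2⟩
      exact ⟨hx, by simpa [mul_assoc] using h2⟩
    · rw [← abs_mul]
      exact le_of_eq (by ring_nf)
    · rw [mul_assoc, ← abs_mul]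
      refine le_trans (le_of_eq (by ring_nf)) (le_mul_of_one_le_left (abs_nonneg _) hK)
    · rcases le_total (0 : ℝ) (v 0) with h0 | h0
      · exact Or.inl fun x _ y _ hxy => by simp only; gcongr
      · exact Or.inr fun x _ y _ hxy => by
          simp only [sub_le_sub_iff_right]
          exact mul_le_mul_of_nonpos_left hxy h0
    · have hd := (((h.hasDerivAt x hx).const_mul (v 0 : ℝ)).const_sub (v 2 : ℝ)).sub
        ((((hasDerivAt_id x).const_mul (v 0 : ℝ)).const_sub (v 1 : ℝ)).mul (h.hasDerivAt' x hx))
      refine HasDerivAt.congr_deriv hd ?_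
      simp only [id]
      ring

theorem volume_dualNorm_lt_le (h : IsCurvedOn f g k c K (Set.Icc s t)) (h₁ : 0 < T₁)
    (h₂ : 0 < T₂) (h₃ : 0 < T₃) (hρ : 0 < ρ) (hτ : 0 < τ) (hτ1 : τ ≤ 1) (a : Fin 3 → ℤ)
    (hy : ∃ y ∈ Set.Icc s t, ρ ≤ dualNorm f g T₁ T₂ T₃ a y) :
    volume {x ∈ Set.Icc s t | dualNorm f g T₁ T₂ T₃ a x < τ ^ 2 * ρ} ≤
      ENNReal.ofReal (12 * K * τ * (t - s)) := by
  have hK := h.one_le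
  have hc := h.pos
  have hst : 0 ≤ t - s := by
    obtain ⟨y, hy, -⟩ := hy
    linarith [hy.1, hy.2]
  have hlow : ∀ x ∈ Set.Icc s t, ∀ y ∈ Set.Icc s t, |(a 2 : ℝ)| * c * |x - y| ≤
      |(a 1 + a 2 * g x : ℝ) - (a 1 + a 2 * g y)| := by
    intro x hx y hy
    rw [show (a 1 + a 2 * g x : ℝ) - (a 1 + a 2 * g y) = a 2 * (g x - g y) by ring, abs_mul,
      mul_assoc]
    gcongr
    exact (h.abs_sub_bounds Set.ordConnected_Icc hx hy).1
  have hup : ∀ x ∈ Set.Icc s t, ∀ y ∈ Set.Icc s t,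
      |(a 1 + a 2 * g x : ℝ) - (a 1 + a 2 * g y)| ≤ K * (|(a 2 : ℝ)| * c) * |x - y| := by
    intro x hx y hy
    rw [show (a 1 + a 2 * g x : ℝ) - (a 1 + a 2 * g y) = a 2 * (g x - g y) by ring, abs_mul,
      show K * (|(a 2 : ℝ)| * c) * |x - y| = |(a 2 : ℝ)| * (K * c * |x - y|) by ring]
    gcongr
    exact (h.abs_sub_bounds Set.ordConnected_Icc hx hy).2
  have hmono : MonotoneOn (fun x => (a 1 + a 2 * g x : ℝ)) (Set.Icc s t) ∨
      AntitoneOn (fun x => (a 1 + a 2 * g x : ℝ)) (Set.Icc s t) := by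
    rcases le_total (0 : ℝ) (a 2) with h0 | h0 <;> rcases h.mono with hm | hm
    · exact Or.inl fun x hx y hy hxy =>
        add_le_add_right (mul_le_mul_of_nonneg_left (hm hx hy hxy) h0) _
    · exact Or.inr fun x hx y hy hxy =>
        add_le_add_right (mul_le_mul_of_nonneg_left (hm hx hy hxy) h0) _
    · exact Or.inr fun x hx y hy hxy =>
        add_le_add_right (mul_le_mul_of_nonpos_left (hm hx hy hxy) h0) _
    · exact Or.inl fun x hx y hy hxy =>
        add_le_add_right (mul_le_mul_of_nonpos_left (hm hx hy hxy) h0) _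
  simp only [dualNorm, max_lt_iff, ← lt_div_iff₀ h₁, ← lt_div_iff₀ h₂, ← lt_div_iff₀ h₃]
  simp only [dualNorm, le_max_iff, ← div_le_iff₀ h₁, ← div_le_iff₀ h₂, ← div_le_iff₀ h₃] at hy
  obtain ⟨y, hyI, hy | hy | hy⟩ := hy
  · refine (measure_mono ?_).trans (volume_sublevel_le_of_hasDerivAt (m := |(a 2 : ℝ)| * c)
      (h := fun x => a 0 + a 1 * x + a 2 * f x)
      (l := fun x => a 1 + a 2 * g x) (k := fun _ => 1) (τ := τ) (ρ := ρ / T₁) (d₁ := 1) (d₂ := 1)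
      (by positivity) hK (by positivity)
      hτ hlow hup hmono one_pos (by linarith) (by simp) (fun x hx => ?_)
      ⟨y, hyI, hy⟩)
    · rintro x ⟨hx, h2, -, -⟩
      exact ⟨hx, by simpa [mul_div_assoc] using h2⟩
    · have hd := (((hasDerivAt_id x).const_mul (a 1 : ℝ)).const_add (a 0 : ℝ)).add
        ((h.hasDerivAt x hx).const_mul (a 2 : ℝ))
      refine HasDerivAt.congr_deriv hd ?_
      ring
  · refine (measure_mono ?_).trans ((volume_sublevel_le_of_biLipschitz (m := |(a 2 : ℝ)| * c)
      (l := fun x => a 1 + a 2 * g x) (τ := τ ^ 2) (S := ρ / T₂) (by positivity) hK (by positivity)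
      (by positivity) hlow hup ⟨y, hyI, hy⟩).trans
      (ENNReal.ofReal_le_ofReal ?_))
    · rintro x ⟨hx, -, h2, -⟩
      exact ⟨hx, by simpa [mul_div_assoc] using h2⟩
    · have : τ ^ 2 ≤ 3 * τ := by nlinarith
      calc 4 * K * τ ^ 2 * (t - s) ≤ 4 * K * (3 * τ) * (t - s) := by gcongr
        _ = _ := by ring
  · refine le_of_eq_of_le ?_ zero_le
    convert measure_empty (μ := volume)
    refine Set.eq_empty_of_forall_notMem fun x hx => ?_
    have : τ ^ 2 * ρ / T₃ ≤ 1 * ρ / T₃ := by gcongr; nlinarith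
    rw [one_mul] at this
    linarith [hx.2.2.2]

theorem exists_le_primalNorm {α β : ℝ} (hαβ : α < β) (h₁ : 0 < T₁) (h₂ : 0 < T₂) (h₃ : 0 < T₃)
    (hT₂ : T₂ ≤ 4) (hT₂' : T₂ ≤ 2 * (β - α)) (hT₃ : T₃ ≤ 4) {v : Fin 3 → ℤ} (hv : v ≠ 0) :
    ∃ y ∈ Set.Icc α β, 1 / 4 ≤ primalNorm f g T₁ T₂ T₃ v y := by
  have hα : α ∈ Set.Icc α β := ⟨le_rfl, hαβ.le⟩
  have hβ : β ∈ Set.Icc α β := ⟨hαβ.le, le_rfl⟩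
  by_contra! hcon
  have hA := (primalNorm_lt_iff h₁ h₂ h₃).1 (hcon α hα)
  have hB := (primalNorm_lt_iff h₁ h₂ h₃).1 (hcon β hβ)
  have h0 : v 0 = 0 := by
    by_contra h0
    have h1 : (1 : ℝ) ≤ |(v 0 : ℝ)| := by exact_mod_cast Int.one_le_abs h0
    have h2 : |(v 0 : ℝ)| * (β - α) ≤ 2 * (1 / 4 * T₂) := by
      calc |(v 0 : ℝ)| * (β - α) = |(v 0 : ℝ) * (β - α)| := by
            rw [abs_mul, abs_of_pos (sub_pos.2 hαβ)]
        _ = |(v 1 - v 0 * α : ℝ) - (v 1 - v 0 * β)| := by ring_nf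
        _ ≤ _ := by linarith [abs_sub (v 1 - v 0 * α : ℝ) (v 1 - v 0 * β), hA.2.1, hB.2.1]
    have h3 : |(v 0 : ℝ)| * (β - α) < β - α := by
      have := abs_sub (v 1 - v 0 * α : ℝ) (v 1 - v 0 * β)
      calc |(v 0 : ℝ)| * (β - α) = |(v 0 : ℝ) * (β - α)| := by
            rw [abs_mul, abs_of_pos (sub_pos.2 hαβ)]
        _ = |(v 1 - v 0 * α : ℝ) - (v 1 - v 0 * β)| := by ring_nf
        _ < _ := by linarith [hA.2.1, hB.2.1]
    nlinarith
  have h1 : v 1 = 0 := by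
    by_contra h1
    have h2 : (1 : ℝ) ≤ |(v 1 : ℝ)| := by exact_mod_cast Int.one_le_abs h1
    have := hA.2.1
    simp only [h0, Int.cast_zero, zero_mul, sub_zero] at this
    linarith
  have h2 : v 2 = 0 := by
    by_contra h2
    have h3 : (1 : ℝ) ≤ |(v 2 : ℝ)| := by exact_mod_cast Int.one_le_abs h2
    have := hA.2.2
    simp only [h0, h1, Int.cast_zero, zero_mul, sub_zero] at this
    linarith
  exact hv (funext fun i => by fin_cases i <;> simpa)

theorem exists_le_dualNorm {α β : ℝ} (h : IsCurvedOn f g k c K (Set.Icc α β)) (hαβ : α < β)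
    (h₁ : 0 < T₁) (hT : 1 ≤ T₁) (hT' : 1 ≤ T₁ * (β - α)) (hT'' : 9 ≤ T₁ * (c * (β - α) ^ 2))
    {a : Fin 3 → ℤ} (ha : a ≠ 0) :
    ∃ y ∈ Set.Icc α β, 1 / 4 ≤ dualNorm f g T₁ T₂ T₃ a y := by
  suffices ∃ y ∈ Set.Icc α β, 1 / 4 ≤ |(a 0 + a 1 * y + a 2 * f y : ℝ)| * T₁ by
    obtain ⟨y, hy, hy'⟩ := this
    exact ⟨y, hy, hy'.trans (le_max_left _ _)⟩
  have hα : α ∈ Set.Icc α β := ⟨le_rfl, hαβ.le⟩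
  have hβ : β ∈ Set.Icc α β := ⟨hαβ.le, le_rfl⟩
  by_contra! hcon
  have h2 : a 2 = 0 := by
    by_contra h2
    have h3 : (1 : ℝ) ≤ |(a 2 : ℝ)| := by exact_mod_cast Int.one_le_abs h2
    set F : ℝ → ℝ := fun x => a 0 + a 1 * x + a 2 * f x with hF
    have hderiv : ∀ x ∈ Set.Icc α β, HasDerivAt F (a 1 + a 2 * g x) x := fun x hx => by
      have hd := (((hasDerivAt_id x).const_mul (a 1 : ℝ)).const_add (a 0 : ℝ)).add
        ((h.hasDerivAt x hx).const_mul (a 2 : ℝ))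
      refine HasDerivAt.congr_deriv hd ?_
      ring
    set w := (β - α) / 3 with hw
    have hw0 : 0 < w := by positivity [sub_pos.2 hαβ]
    have hmvt : ∀ u v, α ≤ u → v = u + w → v ≤ β →
        ∃ ξ ∈ Set.Ioo u v, F v - F u = w * (a 1 + a 2 * g ξ) := by
      intro u v hu hv hvβ
      have hsub : Set.Icc u v ⊆ Set.Icc α β := Set.Icc_subset_Icc hu hvβ
      obtain ⟨ξ, hξ, e⟩ := exists_hasDerivAt_eq_slope F (fun x => a 1 + a 2 * g x)
        (show u < v by linarith)
        (fun x hx => (hderiv x (hsub hx)).continuousAt.continuousWithinAt)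
        (fun x hx => hderiv x (hsub (Set.Ioo_subset_Icc_self hx)))
      refine ⟨ξ, hξ, ?_⟩
      rw [e, hv, add_sub_cancel_left]
      field_simp
    obtain ⟨ξ, hξ, e⟩ := hmvt α (α + w) le_rfl rfl (by linarith)
    obtain ⟨η, hη, e'⟩ := hmvt (α + 2 * w) β (by linarith) (by linarith) le_rfl
    have hgap : c * w ≤ |g η - g ξ| := by
      refine le_trans ?_ (h.abs_sub_bounds Set.ordConnected_Icc (x := η) (y := ξ)
        ⟨by linarith [hη.1], hη.2.le⟩ ⟨hξ.1.le, by linarith [hξ.2]⟩).1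
      have := h.pos
      gcongr
      exact le_trans (by linarith [hη.1, hξ.2]) (le_abs_self _)
    have hsum : c * w ^ 2 ≤ |F β| + |F (α + 2 * w)| + (|F (α + w)| + |F α|) := by
      have e3 : w * (a 2 * (g η - g ξ)) = (F β - F (α + 2 * w)) - (F (α + w) - F α) := by
        rw [e, e']; ring
      have e4 : |w * (a 2 * (g η - g ξ))| = w * (|(a 2 : ℝ)| * |g η - g ξ|) := by
        rw [abs_mul, abs_mul, abs_of_pos hw0]
      have e5 : w * (c * w) ≤ w * (|(a 2 : ℝ)| * |g η - g ξ|) := by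
        exact mul_le_mul_of_nonneg_left
          (hgap.trans (le_mul_of_one_le_left (abs_nonneg _) h3)) hw0.le
      rw [← e4, e3] at e5
      have e6 := abs_sub (F β - F (α + 2 * w)) (F (α + w) - F α)
      have e7 := abs_sub (F β) (F (α + 2 * w))
      have e8 := abs_sub (F (α + w)) (F α)
      linarith
    have i1 := hcon α hα
    have i2 := hcon β hβ
    have i3 := hcon (α + w) ⟨by linarith, by linarith⟩
    have i4 := hcon (α + 2 * w) ⟨by linarith, by linarith⟩
    have i5 : c * w ^ 2 * T₁ < 1 := by
      calc _ ≤ (|F β| + |F (α + 2 * w)| + (|F (α + w)| + |F α|)) * T₁ := by gcongr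
        _ < 1 := by simp only [hF]; linarith
    have i6 : c * w ^ 2 * T₁ = T₁ * (c * (β - α) ^ 2) / 9 := by rw [hw]; ring
    linarith
  have h1 : a 1 = 0 := by
    by_contra h1
    have h3 : (1 : ℝ) ≤ |(a 1 : ℝ)| := by exact_mod_cast Int.one_le_abs h1
    have i1 := hcon α hα
    have i2 := hcon β hβ
    simp only [h2, Int.cast_zero, zero_mul, add_zero] at i1 i2
    have i3 : |(a 1 : ℝ)| * (β - α) ≤ |(a 0 + a 1 * β : ℝ)| + |(a 0 + a 1 * α : ℝ)| := by
      calc |(a 1 : ℝ)| * (β - α) = |(a 1 : ℝ) * (β - α)| := by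
            rw [abs_mul, abs_of_pos (sub_pos.2 hαβ)]
        _ = |(a 0 + a 1 * β : ℝ) - (a 0 + a 1 * α)| := by ring_nf
        _ ≤ _ := abs_sub _ _
    have i4 : β - α ≤ |(a 1 : ℝ)| * (β - α) :=
      le_mul_of_one_le_left (sub_pos.2 hαβ).le h3
    have i5 : T₁ * (β - α) ≤ T₁ * (|(a 0 + a 1 * β : ℝ)| + |(a 0 + a 1 * α : ℝ)|) := by
      gcongr; linarith
    linarith
  have h0 : a 0 = 0 := by
    by_contra h0
    have h3 : (1 : ℝ) ≤ |(a 0 : ℝ)| := by exact_mod_cast Int.one_le_abs h0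
    have i1 := hcon α hα
    simp only [h1, h2, Int.cast_zero, zero_mul, add_zero] at i1
    nlinarith
  exact ha (funext fun i => by fin_cases i <;> simpa)

end IsCurvedOn

/-- Outside a set of small measure, the lattices attached to the points of a curved graph have no
short vectors. -/
theorem exists_volume_primalNorm_lt_le : ∃ N : ℕ, ∀ {f g k : ℝ → ℝ} {c K α β T₁ T₂ T₃ τ : ℝ},
    IsCurvedOn f g k c K (Set.Icc α β) → α < β → 0 < T₁ → 0 < T₂ → 0 < T₃ → T₁ * T₂ * T₃ = 1 →
    1 ≤ T₁ → 1 ≤ T₁ * (β - α) → 9 ≤ T₁ * (c * (β - α) ^ 2) →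
    T₂ ≤ 4 → T₂ ≤ 2 * (β - α) → T₃ ≤ 4 → 0 < τ → τ ≤ 1 →
    volume {x ∈ Set.Icc α β | ∃ v, IsPrimitiveVector v ∧
      primalNorm f g T₁ T₂ T₃ v x < τ ^ 2 * (1 / 4)} ≤
      N * ENNReal.ofReal (12 * K * τ) * volume (Set.Icc α β) := by
  obtain ⟨N, hN⟩ := exists_nondivergence_const
  refine ⟨N, fun {f g k c K α β T₁ T₂ T₃ τ} h hαβ h₁ h₂ h₃ hT hT1 hT1' hT1'' hT2 hT2' hT3 hτ hτ1 =>
    ?_⟩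
  let ι := {v : Fin 3 → ℤ // IsPrimitiveVector v} ⊕ {v : Fin 3 → ℤ // IsPrimitiveVector v}
  let φ : ι → ℝ → ℝ := Sum.elim (fun v => primalNorm f g T₁ T₂ T₃ v)
    (fun a => dualNorm f g T₁ T₂ T₃ a)
  let R : ι → ι → Prop := Sum.elim
    (fun v => Sum.elim (fun _ => False) (fun a => dotProduct a.1 v.1 = 0))
    (fun a => Sum.elim (fun v => dotProduct a.1 v.1 = 0) (fun _ => False))
  have hτ2 : τ ^ 2 ≤ 1 := by nlinarith
  have hτ0 : 0 < τ ^ 2 := by positivity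
  have hf := h.continuousOn
  have hg := h.continuousOn'
  have hK := h.one_le
  refine hN (ι := ι) (φ := φ) (R := R) (ρ := 1 / 4) (ε := τ ^ 2 * (1 / 4)) ?_ ?_ ?_ ?_
    (Set.sep_subset _ _) ?_ ?_ ?_
  · rintro (v | a)
    · change ContinuousOn (fun x => primalNorm f g T₁ T₂ T₃ v x) _
      unfold primalNorm
      fun_prop
    · change ContinuousOn (fun x => dualNorm f g T₁ T₂ T₃ a x) _
      unfold dualNorm
      fun_prop
  · rintro (v | a)
    · exact IsCurvedOn.exists_le_primalNorm hαβ h₁ h₂ h₃ hT2 hT2' hT3 v.2.ne_zero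
    · exact h.exists_le_dualNorm hαβ h₁ hT1 hT1' hT1'' a.2.ne_zero
  · intro x _
    refine (((finite_primalNorm_lt (f := f) (g := g) (x := x) h₁ h₂ h₃ (1 / 4)).preimage
      (Subtype.val_injective (p := IsPrimitiveVector)).injOn).image Sum.inl |>.union
      (((finite_dualNorm_lt (f := f) (g := g) (x := x) h₁ h₂ h₃ (1 / 4)).preimage
      (Subtype.val_injective (p := IsPrimitiveVector)).injOn).image Sum.inr)).subset ?_
    rintro (v | a) hi
    · exact Or.inl ⟨v, hi, rfl⟩
    · exact Or.inr ⟨a, hi, rfl⟩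
  · intro i s t hst hy
    rw [Real.volume_Icc, ← ENNReal.ofReal_mul (by positivity)]
    rcases i with v | a
    · exact (h.subset hst).volume_primalNorm_lt_le h₁ h₂ h₃ (by norm_num) hτ hτ1 v hy
    · exact (h.subset hst).volume_dualNorm_lt_le h₁ h₂ h₃ (by norm_num) hτ hτ1 a hy
  · rintro x ⟨-, w, hw, hwx⟩
    exact ⟨Sum.inl ⟨w, hw⟩, lt_of_lt_of_le hwx (by linarith)⟩
  all_goals
    rintro x ⟨-, w, hw, hwx⟩
    have hw0 := primalNorm_nonneg (f := f) (g := g) (T₂ := T₂) (T₃ := T₃) (x := x) h₁ w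
    have hcross : ∀ v, IsPrimitiveVector v → τ ^ 2 * (1 / 4) ≤ primalNorm f g T₁ T₂ T₃ v x →
        crossProduct w v ≠ 0 := by
      intro v hv hvx h0
      obtain ⟨k, rfl⟩ := hv.exists_eq_smul h0
      have hk : k ≠ 0 := by
        rintro rfl
        exact hw.ne_zero (zero_smul _ _)
      linarith [primalNorm_le_smul (f := f) (g := g) (T₂ := T₂) (T₃ := T₃) (x := x) h₁ hk v]
    have hcross' : ∀ v, primalNorm f g T₁ T₂ T₃ v x < 1 / 4 →
        dualNorm f g T₁ T₂ T₃ (crossProduct w v) x < τ ^ 2 * (1 / 4) := by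
      intro v hvx
      have h1 := dualNorm_crossProduct_le (f := f) (g := g) (x := x) h₁ h₂ h₃ hT w v
      have hv0 := primalNorm_nonneg (f := f) (g := g) (T₂ := T₂) (T₃ := T₃) (x := x) h₁ v
      nlinarith
    have hdot : ∀ a, dualNorm f g T₁ T₂ T₃ a x < 1 / 4 → dotProduct a w = 0 := by
      intro a hax
      have h1 := abs_dotProduct_le (f := f) (g := g) (x := x) h₁ h₂ h₃ a w
      have ha0 := dualNorm_nonneg (f := f) (g := g) (T₂ := T₂) (T₃ := T₃) (x := x) h₁ a
      have h2 : |((dotProduct a w : ℤ) : ℝ)| < 1 := by nlinarith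
      rw [← Int.abs_lt_one_iff]
      exact_mod_cast h2
  · rintro (v | a) hε hρ
    · obtain ⟨k, a, hk, ha, e⟩ := exists_isPrimitiveVector_smul (hcross v v.2 hε)
      refine ⟨Sum.inr ⟨a, ha⟩, ?_, ?_⟩
      · have h1 : dotProduct (crossProduct w v.1) v.1 = 0 := by
          rw [dotProduct_comm, dot_cross_self]
        rw [e, smul_dotProduct, smul_eq_mul] at h1
        exact (mul_eq_zero.1 h1).resolve_left hk
      · have h1 := hcross' v hρ
        rw [e] at h1
        have h2 := dualNorm_le_smul (f := f) (g := g) (T₂ := T₂) (T₃ := T₃) (x := x) h₁ hk a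
        change dualNorm f g T₁ T₂ T₃ a x < 1 / 4
        linarith
    · exact ⟨Sum.inl ⟨w, hw⟩, hdot a hρ, lt_of_lt_of_le hwx (by linarith)⟩
  · have main : ∀ v a : Fin 3 → ℤ, IsPrimitiveVector v → IsPrimitiveVector a →
        dotProduct a v = 0 → τ ^ 2 * (1 / 4) ≤ primalNorm f g T₁ T₂ T₃ v x →
        primalNorm f g T₁ T₂ T₃ v x < 1 / 4 → τ ^ 2 * (1 / 4) ≤ dualNorm f g T₁ T₂ T₃ a x →
        dualNorm f g T₁ T₂ T₃ a x < 1 / 4 → False := by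
      intro v a hv ha hav hv1 hv2 ha1 ha2
      have haw := hdot a ha2
      have h0 : crossProduct (crossProduct w v) a = 0 := by
        rw [cross_cross_eq_smul_sub_smul, dotProduct_comm w a, haw, dotProduct_comm v a, hav]
        simp
      obtain ⟨k, e⟩ := ha.exists_eq_smul h0
      have hk : k ≠ 0 := by
        rintro rfl
        exact hcross v hv hv1 (by rw [e, zero_smul])
      have h1 := hcross' v hv2
      rw [e] at h1
      linarith [dualNorm_le_smul (f := f) (g := g) (T₂ := T₂) (T₃ := T₃) (x := x) h₁ hk a]
    rintro (v | a) (v' | a') hR h1 h2 h3 h4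
    · exact hR
    · exact main v a' v.2 a'.2 hR h1 h2 h3 h4
    · exact main v' a v'.2 a.2 hR h3 h4 h1 h2
    · exact hR

/-- A case of Minkowski's linear forms theorem. -/
theorem exists_int_linear_forms_lt {A B C : ℝ} (hA : 0 < A) (hB : 0 < B) (hC : 0 < C)
    (hABC : 1 < A * B * C) (x y z : ℝ) :
    ∃ v : Fin 3 → ℤ, v ≠ 0 ∧ |(v 0 : ℝ)| < A ∧ |(v 1 - v 0 * x : ℝ)| < B ∧
      |(v 2 - v 0 * y - (v 1 - v 0 * x) * z : ℝ)| < C := by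
  let b := Pi.basisFun ℝ (Fin 3)
  let M : Matrix (Fin 3) (Fin 3) ℝ := !![1, 0, 0; -x, 1, 0; x * z - y, -z, 1]
  have hM : LinearMap.det (Matrix.toLin' M) = 1 := by
    rw [LinearMap.det_toLin', Matrix.det_fin_three]
    simp [M]
  let W : Fin 3 → ℝ := ![A, B, C]
  have hW : ∀ i, 0 < W i := by intro i; fin_cases i <;> simpa [W]
  let box : Set (Fin 3 → ℝ) := Set.univ.pi fun i => Set.Ioo (-W i) (W i)
  have hvol : volume (Matrix.toLin' M ⁻¹' box) = ENNReal.ofReal (8 * (A * B * C)) := by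
    rw [Measure.addHaar_preimage_linearMap _ (by rw [hM]; exact one_ne_zero), hM, volume_pi_pi]
    simp only [Real.volume_Ioo, Fin.prod_univ_three, inv_one, abs_one, ENNReal.ofReal_one, one_mul]
    rw [← ENNReal.ofReal_mul (by linarith [hW 0]),
      ← ENNReal.ofReal_mul (by have := hW 0; have := hW 1; nlinarith)]
    congr 1
    simp only [W, Matrix.cons_val]
    ring
  have hfund : volume (ZSpan.fundamentalDomain b) = 1 := by
    rw [ZSpan.volume_fundamentalDomain]
    have : (Matrix.of b : Matrix (Fin 3) (Fin 3) ℝ) = 1 := by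
      ext i j
      simp [b, Pi.basisFun_apply, Matrix.one_apply, Pi.single_apply, eq_comm]
    rw [this, Matrix.det_one]
    simp
  have : Countable (Submodule.span ℤ (Set.range b)).toAddSubgroup :=
    inferInstanceAs (Countable (Submodule.span ℤ (Set.range b)))
  obtain ⟨⟨w, hwL⟩, hw0, hw⟩ := exists_ne_zero_mem_lattice_of_measure_mul_two_pow_lt_measure
    (μ := volume) (s := Matrix.toLin' M ⁻¹' box)
    (ZSpan.isAddFundamentalDomain' b volume)
    (by
      intro p hp
      simp only [Set.mem_preimage, map_neg, box, Set.mem_univ_pi, Set.mem_Ioo, Pi.neg_apply]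
        at hp ⊢
      exact fun i => ⟨by linarith [(hp i).2], by linarith [(hp i).1]⟩)
    ((convex_pi fun i _ => convex_Ioo _ _).linear_preimage _)
    (by
      rw [hfund, hvol, one_mul, Module.finrank_fin_fun,
        show (2 : ENNReal) ^ 3 = ENNReal.ofReal 8 by norm_num]
      exact (ENNReal.ofReal_lt_ofReal_iff (by linarith)).2 (by linarith))
  have hwZ : ∀ i, ∃ n : ℤ, (n : ℝ) = w i := by
    have := (b.mem_span_iff_repr_mem ℤ w).1 hwL
    intro i
    simpa [b] using this i
  choose v hv using hwZ
  refine ⟨v, ?_, ?_⟩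
  · rintro rfl
    refine hw0 (Subtype.ext (funext fun i => ?_))
    simp [← hv]
  · have hw' : ∀ i, |Matrix.toLin' M w i| < W i := fun i =>
      abs_lt.2 (hw i (Set.mem_univ i))
    have h0 := hw' 0
    have h1 := hw' 1
    have h2 := hw' 2
    simp only [M, W, Matrix.toLin'_apply, Matrix.mulVec, Matrix.vec3_dotProduct, Matrix.of_apply,
      Matrix.cons_val, ← hv] at h0 h1 h2
    refine ⟨?_, ?_, ?_⟩
    · convert h0 using 2; ring
    · convert h1 using 2; ring
    · convert h2 using 2; ring

theorem den2_div_eq {v : Fin 3 → ℤ} (hv : IsPrimitiveVector v) (h0 : 0 < v 0) :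
    ((den2 ((v 1 / v 0 : ℚ), (v 2 / v 0 : ℚ)) : ℕ) : ℤ) = v 0 := by
  obtain ⟨u, hu⟩ := hv
  have h0' : (v 0 : ℚ) ≠ 0 := by exact_mod_cast h0.ne'
  set D := den2 ((v 1 / v 0 : ℚ), (v 2 / v 0 : ℚ)) with hD
  have key : ∀ n : ℤ, ((n / v 0 : ℚ).den) ∣ D → v 0 ∣ D * n := by
    rintro n ⟨e, he⟩
    refine ⟨e * (n / v 0 : ℚ).num, ?_⟩
    have h1 := Rat.mul_den_eq_num (n / v 0 : ℚ)
    have h2 : (D : ℚ) * n = v 0 * (e * (n / v 0 : ℚ).num) := by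
      rw [he, ← h1]
      push_cast
      field_simp
    exact_mod_cast h2
  refine Int.dvd_antisymm (Int.natCast_nonneg _) h0.le ?_ ?_
  · rw [Int.natCast_dvd]
    have hd : ∀ n : ℤ, ((n / v 0 : ℚ).den : ℤ) ∣ v 0 := fun n => by
      rw [← Rat.divInt_eq_div]
      exact Rat.den_dvd _ _
    exact Nat.lcm_dvd (Int.natCast_dvd.1 (hd _)) (Int.natCast_dvd.1 (hd _))
  · have h1 := key (v 1) (Nat.dvd_lcm_left _ _)
    have h2 := key (v 2) (Nat.dvd_lcm_right _ _)
    rw [Matrix.vec3_dotProduct] at hu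
    have e : (D : ℤ) = v 0 * (D * u 0) + D * v 1 * u 1 + D * v 2 * u 2 := by
      linear_combination (-(D : ℤ)) * hu
    rw [e]
    exact ((dvd_mul_right _ _).add (h1.mul_right _)).add (h2.mul_right _)

theorem IsCurvedOn.abs_sub_tangent_le {f g k : ℝ → ℝ} {c K : ℝ} {J : Set ℝ}
    (h : IsCurvedOn f g k c K J) (hJ : J.OrdConnected) {x y : ℝ} (hx : x ∈ J) (hy : y ∈ J) :
    |f y - f x - (y - x) * g x| ≤ K * c * (y - x) ^ 2 := by
  have hKc : 0 ≤ K * c := mul_nonneg (by linarith [h.one_le]) h.pos.le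
  have hmvt : ∃ ξ ∈ J, |ξ - x| ≤ |y - x| ∧ f y - f x = g ξ * (y - x) := by
    rcases lt_trichotomy x y with hxy | rfl | hxy
    · obtain ⟨ξ, hξ, e⟩ := exists_hasDerivAt_eq_slope f g hxy
        (h.continuousOn.mono (hJ.out hx hy))
        (fun z hz => h.hasDerivAt z (hJ.out hx hy (Set.Ioo_subset_Icc_self hz)))
      refine ⟨ξ, hJ.out hx hy (Set.Ioo_subset_Icc_self hξ), ?_, ?_⟩
      · rw [abs_of_pos (sub_pos.2 hξ.1), abs_of_pos (sub_pos.2 hxy)]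
        linarith [hξ.2]
      · rw [e, div_mul_cancel₀ _ (sub_pos.2 hxy).ne']
    · exact ⟨x, hx, by simp, by simp⟩
    · obtain ⟨ξ, hξ, e⟩ := exists_hasDerivAt_eq_slope f g hxy
        (h.continuousOn.mono (hJ.out hy hx))
        (fun z hz => h.hasDerivAt z (hJ.out hy hx (Set.Ioo_subset_Icc_self hz)))
      refine ⟨ξ, hJ.out hy hx (Set.Ioo_subset_Icc_self hξ), ?_, ?_⟩
      · rw [abs_of_neg (sub_neg.2 hξ.2), abs_of_neg (sub_neg.2 hxy)]
        linarith [hξ.1]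
      · have := (sub_pos.2 hxy).ne'
        rw [e]
        field_simp
        ring
  obtain ⟨ξ, hξ, hle, e⟩ := hmvt
  have h1 := (h.abs_sub_bounds hJ hξ hx).2
  rw [e, show g ξ * (y - x) - (y - x) * g x = (g ξ - g x) * (y - x) by ring, abs_mul,
    ← sq_abs (y - x), sq, ← mul_assoc]
  gcongr
  exact h1.trans (by gcongr)

theorem isCurvedOn_of_contDiffOn {a b c₁ c₂ : ℝ} (hab : a < b) {f : ℝ → ℝ}
    (hf : ContDiffOn ℝ 3 f (Set.Ioo a b)) (hc₁ : 0 < c₁)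
    (hfb : ∀ x ∈ Set.Ioo a b,
      c₁ ≤ |iteratedDerivWithin 2 f (Set.Ioo a b) x| ∧
      |iteratedDerivWithin 2 f (Set.Ioo a b) x| ≤ c₂) :
    IsCurvedOn f (deriv f) (deriv (deriv f)) c₁ (c₂ / c₁) (Set.Ioo a b) := by
  have hf' : ContDiffOn ℝ 1 (deriv f) (Set.Ioo a b) :=
    hf.deriv_of_isOpen isOpen_Ioo (by norm_num)
  have hd1 : ∀ x ∈ Set.Ioo a b, HasDerivAt f (deriv f x) x := fun x hx =>
    ((hf.differentiableOn (by norm_num)).differentiableAt (isOpen_Ioo.mem_nhds hx)).hasDerivAt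
  have hd2 : ∀ x ∈ Set.Ioo a b, HasDerivAt (deriv f) (deriv (deriv f) x) x := fun x hx =>
    ((hf'.differentiableOn (by norm_num)).differentiableAt (isOpen_Ioo.mem_nhds hx)).hasDerivAt
  have hb : ∀ x ∈ Set.Ioo a b, c₁ ≤ |deriv (deriv f) x| ∧ |deriv (deriv f) x| ≤ c₂ := by
    intro x hx
    have := hfb x hx
    rwa [iteratedDerivWithin_of_isOpen isOpen_Ioo hx, iteratedDeriv_succ, iteratedDeriv_one]
      at this
  have hmid : (a + b) / 2 ∈ Set.Ioo a b := ⟨by linarith, by linarith⟩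
  refine ⟨hc₁, ?_, hd1, hd2, ?_, ?_⟩
  · rw [one_le_div hc₁]
    exact (hb _ hmid).1.trans (hb _ hmid).2
  · rwa [div_mul_cancel₀ _ hc₁.ne']
  · have hne : ∀ x ∈ Set.Ioo a b, deriv (deriv f) x ≠ 0 := fun x hx h0 => by
      have := (hb x hx).1
      rw [h0, abs_zero] at this
      linarith
    have hint : interior (Set.Ioo a b) = Set.Ioo a b := interior_Ioo
    rcases hasDerivWithinAt_forall_lt_or_forall_gt_of_forall_ne (convex_Ioo a b)
      (fun x hx => (hd2 x hx).hasDerivWithinAt) hne with h | h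
    · right
      refine antitoneOn_of_deriv_nonpos (convex_Ioo a b) hf'.continuousOn ?_ ?_
      · rw [hint]; exact hf'.differentiableOn (by norm_num)
      · rw [hint]; exact fun x hx => (h x hx).le
    · left
      refine monotoneOn_of_deriv_nonneg (convex_Ioo a b) hf'.continuousOn ?_ ?_
      · rw [hint]; exact hf'.differentiableOn (by norm_num)
      · rw [hint]; exact fun x hx => (h x hx).le

/-- A point whose lattice has no short vectors is close to a rational point near the curve with
large denominator. Here `p` stands for `ψ Q`. -/
theorem exists_rational_near_of_forall_le_primalNorm {f g k : ℝ → ℝ} {c K : ℝ} {I J : Set ℝ}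
    (h : IsCurvedOn f g k c K J) (hJ : J.OrdConnected) (hIJ : I ⊆ J) {δ ε Q p η x : ℝ}
    (hδ : 0 < δ) (hε : 0 < ε) (hQ : 0 < Q) (hp : 0 < p)
    (hη : 4 / δ ^ 2 / (Q ^ 2 * p) ≤ η) (hxI : Set.Icc (x - η) (x + η) ⊆ I)
    (hlarge : 2 * (K * c) * (4 / δ ^ 2) ^ 2 ≤ δ * (Q * p) ^ 3)
    (hx : ∀ v, IsPrimitiveVector v →
      ε ≤ primalNorm f g (δ * Q / ε) (4 / δ / (Q * p) / ε) (δ / 2 * p / ε) v x) :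
    ∃ r : ℚ × ℚ, (δ / 2 * Q < (den2 r : ℝ) ∧ (den2 r : ℝ) ≤ Q ∧ (r.1 : ℝ) ∈ I ∧
      |f (r.1 : ℝ) - (r.2 : ℝ)| < p / Q) ∧
      x ∈ Metric.ball (r.1 : ℝ) (4 / δ ^ 2 / (Q ^ 2 * p)) := by
  have hη0 : 0 ≤ η := le_trans (by positivity) hη
  have hx0 : x ∈ I := hxI ⟨by linarith, by linarith⟩
  obtain ⟨v, hv, hv0, hvQ, hv2, hv3⟩ : ∃ v : Fin 3 → ℤ, IsPrimitiveVector v ∧ 0 ≤ v 0 ∧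
      |(v 0 : ℝ)| < Q ∧ |(v 1 - v 0 * x : ℝ)| < 4 / δ / (Q * p) ∧
      |(v 2 - v 0 * f x - (v 1 - v 0 * x) * g x : ℝ)| < δ / 2 * p := by
    obtain ⟨w, hw0, hw⟩ := exists_int_linear_forms_lt hQ
      (show 0 < 4 / δ / (Q * p) by positivity) (show 0 < δ / 2 * p by positivity)
      (by field_simp; norm_num) x (f x) (g x)
    obtain ⟨m, v, hm, hv, rfl⟩ := exists_isPrimitiveVector_smul hw0
    have hw' := (primalNorm_lt_iff (c := 1) (f := f) (g := g) (x := x) hQ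
      (show 0 < 4 / δ / (Q * p) by positivity) (show 0 < δ / 2 * p by positivity)).2
      (by simpa only [one_mul] using hw)
    have hv' := (primalNorm_le_smul hQ hm v).trans_lt hw'
    rcases le_total 0 (v 0) with h0 | h0
    · refine ⟨v, hv, h0, ?_⟩
      simpa only [one_mul] using
        (primalNorm_lt_iff hQ (by positivity) (by positivity)).1 hv'
    · refine ⟨-v, ?_, by simpa using h0, ?_⟩
      · obtain ⟨u, hu⟩ := hv
        exact ⟨-u, by simpa using hu⟩
      · have : primalNorm f g Q (4 / δ / (Q * p)) (δ / 2 * p) (-v) x < 1 := by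
          rw [show -v = (-1 : ℤ) • v by simp, primalNorm_smul]
          simpa using hv'
        simpa only [one_mul] using
          (primalNorm_lt_iff hQ (by positivity) (by positivity)).1 this
  have hq : δ * Q ≤ v 0 := by
    by_contra! hlt
    refine absurd (hx v hv) (not_le.2 ((primalNorm_lt_iff (by positivity) (by positivity)
      (by positivity)).2 ⟨?_, ?_, ?_⟩))
    · rw [mul_div_cancel₀ _ hε.ne', abs_of_nonneg (by exact_mod_cast hv0)]
      exact hlt
    · rwa [mul_div_cancel₀ _ hε.ne']
    · rwa [mul_div_cancel₀ _ hε.ne']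
  have hq0 : (0 : ℝ) < v 0 := lt_of_lt_of_le (by positivity) hq
  have hden := den2_div_eq hv (by exact_mod_cast hq0)
  set r : ℚ × ℚ := ((v 1 / v 0 : ℚ), (v 2 / v 0 : ℚ)) with hr
  have hdenR : (den2 r : ℝ) = v 0 := by exact_mod_cast hden
  have hr1 : (r.1 : ℝ) = v 1 / v 0 := by simp [hr]
  have hr2 : (r.2 : ℝ) = v 2 / v 0 := by simp [hr]
  have hdist : |(r.1 : ℝ) - x| < 4 / δ ^ 2 / (Q ^ 2 * p) := by
    rw [hr1, show (v 1 : ℝ) / v 0 - x = (v 1 - v 0 * x) / v 0 by field_simp, abs_div,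
      abs_of_pos hq0, div_lt_iff₀ hq0]
    calc _ < 4 / δ / (Q * p) := hv2
      _ = 4 / δ ^ 2 / (Q ^ 2 * p) * (δ * Q) := by field_simp
      _ ≤ _ := by gcongr
  have hr1I : (r.1 : ℝ) ∈ I := by
    have := abs_lt.1 (hdist.trans_le hη)
    exact hxI ⟨by linarith, by linarith⟩
  refine ⟨r, ⟨?_, ?_, hr1I, ?_⟩, ?_⟩
  · rw [hdenR]
    nlinarith [mul_pos hδ hQ]
  · rw [hdenR]
    exact ((le_abs_self _).trans_lt hvQ).le
  · have htan := h.abs_sub_tangent_le hJ (hIJ hx0) (hIJ hr1I)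
    have hKc : 0 ≤ K * c := mul_nonneg (by linarith [h.one_le]) h.pos.le
    have e : (v 0 : ℝ) * (f r.1 - r.2) = v 0 * (f r.1 - f x - (r.1 - x) * g x) -
        (v 2 - v 0 * f x - (v 1 - v 0 * x) * g x) := by
      rw [hr2, show (v 1 : ℝ) = v 0 * r.1 by rw [hr1]; field_simp]
      field_simp
      ring
    have h1 : (v 0 : ℝ) * |f r.1 - r.2| < δ * p := by
      rw [← abs_of_pos hq0, ← abs_mul, e]
      refine (abs_sub _ _).trans_lt ?_
      rw [abs_mul, abs_of_pos hq0]
      have h2 : (v 0 : ℝ) * |f r.1 - f x - (r.1 - x) * g x| ≤ δ / 2 * p := by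
        have h3 : ((r.1 : ℝ) - x) ^ 2 ≤ (4 / δ ^ 2 / (Q ^ 2 * p)) ^ 2 := by
          rw [← sq_abs]
          gcongr
        calc _ ≤ Q * (K * c * (4 / δ ^ 2 / (Q ^ 2 * p)) ^ 2) := by
              gcongr
              · exact ((le_abs_self _).trans_lt hvQ).le
              · exact htan.trans (by gcongr)
          _ = 2 * (K * c) * (4 / δ ^ 2) ^ 2 / (2 * (Q ^ 3 * p ^ 2)) := by field_simp
          _ ≤ δ * (Q * p) ^ 3 / (2 * (Q ^ 3 * p ^ 2)) := by gcongr
          _ = _ := by field_simp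
      linarith
    rw [lt_div_iff₀ hQ]
    have h4 : δ * Q * |f r.1 - r.2| ≤ v 0 * |f r.1 - r.2| := by gcongr
    have h5 : δ * (|f r.1 - r.2| * Q) < δ * p := by linarith
    exact lt_of_mul_lt_mul_left h5 hδ.le
  · rw [Metric.mem_ball, dist_comm, Real.dist_eq]
    exact hdist

theorem Set.OrdConnected.exists_Ioo_subset {a b : ℝ} {I : Set ℝ} (hI : I.OrdConnected)
    (hab : I ⊆ Set.Ioo a b) (h0 : volume I ≠ 0) :
    ∃ s t : ℝ, s < t ∧ Set.Ioo s t ⊆ I ∧ volume I ≤ ENNReal.ofReal (t - s) := by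
  have hne : I.Nonempty := nonempty_of_measure_ne_zero h0
  have hbb : BddBelow I := bddBelow_Ioo.mono hab
  have hba : BddAbove I := bddAbove_Ioo.mono hab
  have hv : volume I ≤ ENNReal.ofReal (sSup I - sInf I) := by
    rw [← Real.volume_Icc]
    exact measure_mono (subset_Icc_csInf_csSup hbb hba)
  refine ⟨sInf I, sSup I, ?_, ?_, hv⟩
  · by_contra! hle
    rw [ENNReal.ofReal_of_nonpos (by linarith)] at hv
    exact h0 (nonpos_iff_eq_zero.1 hv)
  · rintro x ⟨h1, h2⟩
    obtain ⟨y, hy, hyx⟩ := exists_lt_of_csInf_lt hne h1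
    obtain ⟨z, hz, hxz⟩ := exists_lt_of_lt_csSup hne h2
    exact hI.out hy hz ⟨hyx.le, hxz.le⟩

theorem ubiquity_of_rational_points_near_curve
    (a b : ℝ) (hab : a < b)
    (f : ℝ → ℝ) (hf : ContDiffOn ℝ 3 f (Set.Ioo a b))
    (c₁ c₂ : ℝ) (hc₁ : 0 < c₁)
    (hfb : ∀ x ∈ Set.Ioo a b,
      c₁ ≤ |iteratedDerivWithin 2 f (Set.Ioo a b) x| ∧
      |iteratedDerivWithin 2 f (Set.Ioo a b) x| ≤ c₂)
    (ψ : ℝ → ℝ) (hψ : IsApproxFun ψ)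
    (hψ0 : Tendsto ψ atTop (nhds 0))
    (htψ : Tendsto (fun t : ℝ => t * ψ t) atTop atTop) :
    ∀ I ⊆ Set.Ioo a b, I.OrdConnected →
      ∃ δ₀ > (0 : ℝ), ∃ C₁ > (0 : ℝ), ∀ᶠ Q : ℝ in atTop,
        volume I / 2 ≤
          volume (⋃ r ∈ {r : ℚ × ℚ |
              δ₀ * Q < (den2 r : ℝ) ∧ (den2 r : ℝ) ≤ Q ∧ ((r.1 : ℝ) ∈ I) ∧
              |f (r.1 : ℝ) - (r.2 : ℝ)| < ψ Q / Q},
            Metric.ball ((r.1 : ℝ)) (C₁ / (Q ^ 2 * ψ Q)) ∩ I) := by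
  intro I hIab hI
  rcases eq_or_ne (volume I) 0 with hI0 | hI0
  · exact ⟨1, one_pos, 1, one_pos, Eventually.of_forall fun Q => by simp [hI0]⟩
  obtain ⟨s, t, hst, hstI, hvol⟩ := hI.exists_Ioo_subset hIab hI0
  have hcurve := isCurvedOn_of_contDiffOn hab hf hc₁ hfb
  obtain ⟨N, hN⟩ := exists_volume_primalNorm_lt_le
  set K := c₂ / c₁
  set g := deriv f
  have hK : 1 ≤ K := hcurve.one_le
  set L := t - s with hL
  have hL0 : 0 < L := sub_pos.2 hst
  set α := s + L / 10 with hα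
  set β := t - L / 10 with hβ
  have hαβ : β - α = 4 / 5 * L := by rw [hα, hβ]; ring
  have hαβ' : α < β := by linarith
  have hJI : ∀ x ∈ Set.Icc α β, Set.Icc (x - L / 20) (x + L / 20) ⊆ I := fun x hx y hy =>
    hstI ⟨by linarith [hx.1, hy.1], by linarith [hx.2, hy.2]⟩
  have hJab : Set.Icc α β ⊆ Set.Ioo a b := fun x hx =>
    hIab (hJI x hx ⟨by linarith, by linarith⟩)
  set τ : ℝ := 1 / (48 * K * (N + 1)) with hτdef
  have hτ : 0 < τ := by positivity
  have hτ1 : τ ≤ 1 := by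
    rw [hτdef, div_le_one (by positivity)]
    have : (0 : ℝ) ≤ N := Nat.cast_nonneg N
    nlinarith
  have hNτ : N * (12 * K * τ) ≤ 1 / 4 := by
    have : 12 * K * τ = 1 / (4 * (N + 1)) := by rw [hτdef]; field_simp; norm_num
    rw [this, ← mul_div_assoc, mul_one, div_le_div_iff₀ (by positivity) (by norm_num)]
    linarith
  set ε : ℝ := τ ^ 2 * (1 / 4) with hε
  have hε0 : 0 < ε := by positivity
  set δ : ℝ := ε ^ 3 / 2 with hδ
  have hδ0 : 0 < δ := by positivity
  refine ⟨δ / 2, by positivity, 4 / δ ^ 2, by positivity, ?_⟩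
  have hlim1 : ∀ c > 0, ∀ B : ℝ, ∀ᶠ Q : ℝ in atTop, B ≤ c * Q := fun c hc B =>
    (tendsto_id.const_mul_atTop hc).eventually_ge_atTop B
  have hlim2 : ∀ c > 0, ∀ B : ℝ, ∀ᶠ Q : ℝ in atTop, B ≤ c * (Q * ψ Q) := fun c hc B =>
    (htψ.const_mul_atTop hc).eventually_ge_atTop B
  have hlim3 : ∀ᶠ Q : ℝ in atTop, ψ Q < 4 * ε / (δ / 2) :=
    hψ0.eventually_lt_const (by positivity)
  filter_upwards [eventually_ge_atTop 1, hlim1 (δ / ε) (by positivity) 1,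
    hlim1 (δ / ε * (β - α)) (mul_pos (by positivity) (by linarith)) 1,
    hlim1 (δ / ε * (c₁ * (β - α) ^ 2))
      (mul_pos (by positivity) (mul_pos hc₁ (pow_pos (by linarith) 2))) 9,
    hlim2 4 (by norm_num) (4 / δ / ε), hlim2 (2 * (β - α)) (by linarith) (4 / δ / ε), hlim3,
    hlim2 (L / 20) (by positivity) (4 / δ ^ 2),
    hlim2 1 one_pos 1, hlim2 δ hδ0 (2 * (K * c₁) * (4 / δ ^ 2) ^ 2)]
    with Q hQ1 hT1 hT1' hT1'' hT2 hT2' hT3 hη hX1 hlarge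
  have hQ : 0 < Q := by linarith
  have hp : 0 < ψ Q := hψ.2 Q hQ
  have hX : 0 < Q * ψ Q := by positivity
  have hbad := hN (T₁ := δ * Q / ε) (T₂ := 4 / δ / (Q * ψ Q) / ε) (T₃ := δ / 2 * ψ Q / ε)
    (τ := τ) (hcurve.subset hJab) hαβ' (by positivity) (by positivity) (by positivity)
    (by rw [hδ]; field_simp; norm_num)
    (hT1.trans_eq (by ring)) (hT1'.trans_eq (by ring)) (hT1''.trans_eq (by ring))
    (by rw [div_right_comm, div_le_iff₀ hX]; exact hT2)
    (by rw [div_right_comm, div_le_iff₀ hX]; exact hT2')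
    (by
      rw [div_le_iff₀ hε0]
      have := (lt_div_iff₀ (by positivity)).1 hT3
      linarith) hτ hτ1
  set bad := {x ∈ Set.Icc α β | ∃ v, IsPrimitiveVector v ∧
      primalNorm f g (δ * Q / ε) (4 / δ / (Q * ψ Q) / ε) (δ / 2 * ψ Q / ε) v x < ε}
  set U := ⋃ r ∈ {r : ℚ × ℚ | δ / 2 * Q < (den2 r : ℝ) ∧ (den2 r : ℝ) ≤ Q ∧ ((r.1 : ℝ) ∈ I) ∧
      |f (r.1 : ℝ) - (r.2 : ℝ)| < ψ Q / Q},
    Metric.ball ((r.1 : ℝ)) (4 / δ ^ 2 / (Q ^ 2 * ψ Q)) ∩ I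
  have hcover : Set.Icc α β ⊆ bad ∪ U := by
    intro x hx
    by_cases hxb : x ∈ bad
    · exact Or.inl hxb
    · obtain ⟨r, hr, hxr⟩ := exists_rational_near_of_forall_le_primalNorm (I := I) (ε := ε)
        (δ := δ) (Q := Q) (p := ψ Q) (η := L / 20) (x := x) hcurve Set.ordConnected_Ioo hIab hδ0
        hε0 hQ hp
        (by
          rw [div_le_iff₀ (by positivity)]
          refine hη.trans ?_
          gcongr
          nlinarith)
        (hJI x hx)
        (hlarge.trans (by
          gcongr
          exact le_self_pow₀ (by linarith) (by norm_num)))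
        (fun v hv => not_lt.1 fun hlt => hxb ⟨hx, v, hv, hlt⟩)
      exact Or.inr (Set.mem_biUnion hr ⟨hxr, hJI x hx ⟨by linarith, by linarith⟩⟩)
  have hbad' : volume bad ≤ ENNReal.ofReal (L / 5) := by
    refine hbad.trans ?_
    rw [Real.volume_Icc, ← ENNReal.ofReal_natCast, ← ENNReal.ofReal_mul (by positivity),
      ← ENNReal.ofReal_mul (by positivity)]
    refine ENNReal.ofReal_le_ofReal ?_
    rw [hαβ]
    nlinarith
  have hJU : ENNReal.ofReal (L / 5) + ENNReal.ofReal (L / 2) ≤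
      ENNReal.ofReal (L / 5) + volume U := by
    calc _ = ENNReal.ofReal (L / 5 + L / 2) :=
          (ENNReal.ofReal_add (by positivity) (by positivity)).symm
      _ ≤ volume (Set.Icc α β) := by
          rw [Real.volume_Icc]
          exact ENNReal.ofReal_le_ofReal (by linarith)
      _ ≤ volume bad + volume U := (measure_mono hcover).trans (measure_union_le _ _)
      _ ≤ _ := by gcongr
  calc volume I / 2 ≤ ENNReal.ofReal L / 2 := by gcongr
    _ = ENNReal.ofReal (L / 2) := by
        rw [ENNReal.ofReal_div_of_pos (by norm_num), ENNReal.ofReal_ofNat]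
    _ ≤ volume U := (ENNReal.add_le_add_iff_left ENNReal.ofReal_ne_top).1 hJU
end

section
/- Let I₀ be a finite open interval of ℝ and f ∈ C³(I₀) with 0 < inf_{x∈I₀} |f''(x)| ≤ sup_{x∈I₀} |f''(x)| < ∞. Let ψ be an approximating function with lim_{t→∞} ψ(t) = 0 and lim_{t→∞} t ψ(t) = ∞, let u : ℝ₊ → ℝ₊ be any function with lim_{t→∞} u(t) = ∞, and set ρ(t) := u(t)/(t² ψ(t)). Then there exists a constant κ > 0 such that for every interval I ⊆ I₀: liminf_{t→∞, t∈ℕ} |⋃ ( B(p₁/q, ρ(2^t)) ∩ I )| ≥ κ |I|, where the union is over rational points p/q ∈ ℚ² with q ≤ 2^t and |f(p₁/q) − p₂/q| < ψ(q)/q. That is, the rational points ψ(q)/q-close to the curve {(x, f(x)) : x ∈ I₀} form a locally ubiquitous system with respect to ρ. -/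
open MeasureTheory Filter

/-- If every point of `E` is the centre of a ball in whose fivefold dilation `E` has relative
measure at most `K`, then `E` has relative measure at most `K`. -/
theorem volume_le_of_forall_closedBall {α β : ℝ} {E : Set ℝ} {K : ENNReal}
    (R : ℝ) (h : ∀ x ∈ E, ∃ r, 0 < r ∧ r ≤ R ∧
      volume (E ∩ Metric.closedBall x (5 * r)) ≤
        K * volume (Metric.closedBall x r ∩ Set.Icc α β)) :
    volume E ≤ K * volume (Set.Icc α β) := by
  choose! r hr0 hrR hr using h
  obtain ⟨t, htE, hdisj, hcov⟩ :=
    Vitali.exists_disjoint_subfamily_covering_enlargement_closedBall E id r R hrR 5 (by norm_num)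
  have hcount : t.Countable := by
    refine hdisj.countable_of_nonempty_interior fun x hx => ?_
    exact ⟨x, Metric.ball_subset_interior_closedBall (Metric.mem_ball_self (hr0 x (htE hx)))⟩
  have hsub : E ⊆ ⋃ x ∈ t, E ∩ Metric.closedBall x (5 * r x) := by
    intro x hx
    obtain ⟨y, hy, hxy⟩ := hcov x hx
    simp only [Set.mem_iUnion]
    exact ⟨y, hy, hx, hxy (Metric.mem_closedBall_self (hr0 x hx).le)⟩
  calc volume E ≤ volume (⋃ x ∈ t, E ∩ Metric.closedBall x (5 * r x)) := measure_mono hsub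
    _ ≤ ∑' x : t, volume (E ∩ Metric.closedBall (x : ℝ) (5 * r x)) := measure_biUnion_le _ hcount _
    _ ≤ ∑' x : t, K * volume (Metric.closedBall (x : ℝ) (r x) ∩ Set.Icc α β) :=
        ENNReal.tsum_le_tsum fun x => hr x (htE x.2)
    _ = K * ∑' x : t, volume (Metric.closedBall (x : ℝ) (r x) ∩ Set.Icc α β) :=
        ENNReal.tsum_mul_left
    _ = K * volume (⋃ x ∈ t, Metric.closedBall (x : ℝ) (r x) ∩ Set.Icc α β) := by
        rw [measure_biUnion hcount]
        · exact hdisj.mono fun x => Set.inter_subset_left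
        · exact fun x _ => Metric.isClosed_closedBall.measurableSet.inter measurableSet_Icc
    _ ≤ K * volume (Set.Icc α β) := by
        gcongr
        exact Set.iUnion₂_subset fun _ _ => Set.inter_subset_right

theorem volume_le_of_forall_family {ι : Type*} {G : ι → ℝ → ℝ} {α β c : ℝ} {E : Set ℝ}
    (hαβ : α < β) (hc : 0 ≤ c) (hE : E ⊆ Set.Icc α β)
    (hcont : ∀ i, ContinuousOn (G i) (Set.Icc α β))
    (hsup : ∀ i, ∃ x ∈ Set.Icc α β, 1 ≤ G i x)
    (hsmall : ∀ x ∈ E, ∃ i, G i x < 1)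
    (h : ∀ α' β', α ≤ α' → α' < β' → β' ≤ β → (∀ i, ∃ y ∈ Set.Icc α' β', 1 ≤ G i y) →
      ∀ i, volume {y ∈ E ∩ Set.Icc α' β' | G i y < 1} ≤ ENNReal.ofReal (c * (β' - α'))) :
    volume E ≤ ENNReal.ofReal (10 * c * (β - α)) := by
  rw [ENNReal.ofReal_mul (by positivity), ← Real.volume_Icc]
  refine volume_le_of_forall_closedBall (β - α) fun x hx => ?_
  obtain ⟨hxα, hxβ⟩ := hE hx
  let S : Set ℝ := {r | ∃ i, ∀ y ∈ Set.Icc α β, |y - x| ≤ r → G i y < 1}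
  have hSle : ∀ r ∈ S, r ≤ β - α := by
    rintro r ⟨i, hi⟩
    by_contra! hlt
    obtain ⟨y, hy, hGy⟩ := hsup i
    refine absurd (hi y hy ?_) (not_lt.2 hGy)
    rw [abs_le]; constructor <;> linarith [hy.1, hy.2]
  have hbdd : BddAbove S := ⟨β - α, hSle⟩
  obtain ⟨r₀, hr₀, hr₀S⟩ : ∃ r, 0 < r ∧ r ∈ S := by
    obtain ⟨i, hi⟩ := hsmall x hx
    have := (hcont i x (hE hx)).eventually (gt_mem_nhds hi)
    obtain ⟨δ, hδ, hball⟩ := Metric.mem_nhdsWithin_iff.1 this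
    refine ⟨δ / 2, by positivity, i, fun y hy hyx => hball ⟨?_, hy⟩⟩
    rw [Metric.mem_ball, Real.dist_eq]; linarith
  have hs : 0 < sSup S := hr₀.trans_le (le_csSup hbdd hr₀S)
  obtain ⟨r, hrS, hr⟩ := exists_lt_of_lt_csSup ⟨r₀, hr₀S⟩ (half_lt_self hs)
  have hr0 : 0 < r := by linarith
  have h2r : 2 * r ∉ S := fun hmem => by linarith [le_csSup hbdd hmem]
  obtain ⟨i, hi⟩ := hrS
  refine ⟨r / 5, by positivity, by linarith [hSle r ⟨i, hi⟩], ?_⟩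
  have key := h (max α (x - 2 * r)) (min β (x + 2 * r)) (le_max_left _ _)
    (max_lt (lt_min hαβ (by linarith)) (lt_min (by linarith) (by linarith))) (min_le_left _ _)
    (fun j => by
      by_contra! hj
      refine h2r ⟨j, fun y hy hyx => hj y ?_⟩
      rw [abs_le] at hyx
      exact ⟨max_le hy.1 (by linarith), le_min hy.2 (by linarith)⟩) i
  have hvol : volume (Metric.closedBall x (r / 5) ∩ Set.Icc α β) =
      ENNReal.ofReal (min (x + r / 5) β - max (x - r / 5) α) := by
    rw [Real.closedBall_eq_Icc, Set.Icc_inter_Icc, Real.volume_Icc]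
  rw [hvol, ← ENNReal.ofReal_mul (by positivity)]
  refine (measure_mono ?_).trans (key.trans (ENNReal.ofReal_le_ofReal ?_))
  · rintro y ⟨hyE, hy⟩
    rw [Metric.mem_closedBall, Real.dist_eq] at hy
    have hyr : |y - x| ≤ r := by linarith
    have hyI := hE hyE
    refine ⟨⟨hyE, max_le hyI.1 ?_, le_min hyI.2 ?_⟩, hi y hyI hyr⟩ <;>
      linarith [abs_le.1 hyr]
  · have h1 : min β (x + 2 * r) - max α (x - 2 * r) ≤
        10 * (min (x + r / 5) β - max (x - r / 5) α) := by
      have e1 : min β (x + 2 * r) - x ≤ 10 * (min (x + r / 5) β - x) := by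
        rcases min_cases (x + r / 5) β with ⟨e, _⟩ | ⟨e, _⟩ <;> rw [e]
        · linarith [min_le_right β (x + 2 * r)]
        · linarith [min_le_left β (x + 2 * r)]
      have e2 : x - max α (x - 2 * r) ≤ 10 * (x - max (x - r / 5) α) := by
        rcases max_cases (x - r / 5) α with ⟨e, _⟩ | ⟨e, _⟩ <;> rw [e]
        · linarith [le_max_right α (x - 2 * r)]
        · linarith [le_max_left α (x - 2 * r)]
      linarith
    calc c * _ ≤ c * _ := mul_le_mul_of_nonneg_left h1 hc
      _ = _ := by ring

theorem exists_mem_volume_inter_Ici {α β s t : ℝ} {S : Set ℝ} (hS : S ⊆ Set.Icc α β)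
    (hs : 0 ≤ s) (ht : 0 ≤ t) (h : ENNReal.ofReal (s + t) < volume S) :
    ∃ x ∈ S, ENNReal.ofReal t < volume (S ∩ Set.Ici (x + s)) := by
  have hne : S.Nonempty := nonempty_of_measure_ne_zero (bot_lt_of_lt h).ne'
  have hbdd : BddBelow S := ⟨α, fun x hx => (hS hx).1⟩
  obtain ⟨v, hv, hvS⟩ := ENNReal.lt_iff_exists_real_btwn.1 h
  have hst : s + t < v := (ENNReal.ofReal_lt_ofReal_iff_of_nonneg (by positivity)).1 hvS.1
  obtain ⟨x, hx, hxlt⟩ := exists_lt_of_csInf_lt hne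
    (show sInf S < sInf S + (v - (s + t)) by linarith)
  refine ⟨x, hx, ?_⟩
  by_contra! hle
  have hsub : S ⊆ Set.Icc (sInf S) (x + s) ∪ (S ∩ Set.Ici (x + s)) := by
    intro y hy
    rcases le_total y (x + s) with hys | hys
    · exact Or.inl ⟨csInf_le hbdd hy, hys⟩
    · exact Or.inr ⟨hy, hys⟩
  have hge : sInf S ≤ x := csInf_le hbdd hx
  have : volume S ≤ ENNReal.ofReal v :=
    calc volume S ≤ volume (Set.Icc (sInf S) (x + s)) + volume (S ∩ Set.Ici (x + s)) :=
          (measure_mono hsub).trans (measure_union_le _ _)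
      _ ≤ ENNReal.ofReal (x + s - sInf S) + ENNReal.ofReal t := by
          rw [Real.volume_Icc]; gcongr
      _ = ENNReal.ofReal (x + s - sInf S + t) := (ENNReal.ofReal_add (by linarith) ht).symm
      _ ≤ ENNReal.ofReal v := ENNReal.ofReal_le_ofReal (by linarith)
  exact absurd hvS.2 (not_lt.2 this)

theorem exists_four_separated {α β s : ℝ} {S : Set ℝ} (hS : S ⊆ Set.Icc α β)
    (hs : 0 ≤ s) (h : ENNReal.ofReal (3 * s) < volume S) :
    ∃ x₁ ∈ S, ∃ x₂ ∈ S, ∃ x₃ ∈ S, ∃ x₄ ∈ S, x₁ + s ≤ x₂ ∧ x₂ + s ≤ x₃ ∧ x₃ + s ≤ x₄ := by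
  rw [show 3 * s = s + (s + s) by ring] at h
  obtain ⟨x₁, h₁, h⟩ := exists_mem_volume_inter_Ici hS hs (by positivity) h
  obtain ⟨x₂, h₂, h⟩ := exists_mem_volume_inter_Ici (Set.inter_subset_left.trans hS) hs hs h
  rw [show s = s + 0 by ring] at h
  obtain ⟨x₃, h₃, h⟩ := exists_mem_volume_inter_Ici
    ((Set.inter_subset_left.trans Set.inter_subset_left).trans hS) hs le_rfl h
  obtain ⟨x₄, h₄⟩ := nonempty_of_measure_ne_zero (bot_lt_of_lt h).ne'
  have e₂ : x₁ + s ≤ x₂ := h₂.2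
  have e₃ : x₂ + (s + 0) ≤ x₃ := h₃.2
  have e₄ : x₃ + s ≤ x₄ := h₄.2
  exact ⟨x₁, h₁, x₂, h₂.1, x₃, h₃.1.1, x₄, h₄.1.1.1, e₂, by linarith, e₄⟩

/-- A quantitative goodness condition on `[α, β]`: if `G ≤ η` at four `s`-separated points of a
subinterval, then `G` is controlled on the whole subinterval. -/
def FourPointGood (C α β : ℝ) (G : ℝ → ℝ) : Prop :=
  ∀ ⦃α' β' s η x₁ x₂ x₃ x₄ y : ℝ⦄, α ≤ α' → β' ≤ β → 0 < s → x₁ ∈ Set.Icc α' β' →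
    x₂ ∈ Set.Icc α' β' → x₃ ∈ Set.Icc α' β' → x₄ ∈ Set.Icc α' β' → x₁ + s ≤ x₂ → x₂ + s ≤ x₃ →
    x₃ + s ≤ x₄ → G x₁ ≤ η → G x₂ ≤ η → G x₃ ≤ η → G x₄ ≤ η → y ∈ Set.Icc α' β' →
    G y ≤ C * η * ((β' - α') / s) ^ 2

namespace FourPointGood

variable {C α β : ℝ} {G G' : ℝ → ℝ}

theorem max (h : FourPointGood C α β G) (h' : FourPointGood C α β G') :
    FourPointGood C α β fun x => max (G x) (G' x) := by
  intro α' β' s η x₁ x₂ x₃ x₄ y hα hβ hs m₁ m₂ m₃ m₄ g₁ g₂ g₃ e₁ e₂ e₃ e₄ hy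
  simp only [max_le_iff] at e₁ e₂ e₃ e₄ ⊢
  exact ⟨h hα hβ hs m₁ m₂ m₃ m₄ g₁ g₂ g₃ e₁.1 e₂.1 e₃.1 e₄.1 hy,
    h' hα hβ hs m₁ m₂ m₃ m₄ g₁ g₂ g₃ e₁.2 e₂.2 e₃.2 e₄.2 hy⟩

theorem const_mul (h : FourPointGood C α β G) {k : ℝ} (hk : 0 < k) :
    FourPointGood C α β fun x => k * G x := by
  intro α' β' s η x₁ x₂ x₃ x₄ y hα hβ hs m₁ m₂ m₃ m₄ g₁ g₂ g₃ e₁ e₂ e₃ e₄ hy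
  simp only [← le_div_iff₀' hk] at e₁ e₂ e₃ e₄ ⊢
  refine (h hα hβ hs m₁ m₂ m₃ m₄ g₁ g₂ g₃ e₁ e₂ e₃ e₄ hy).trans_eq ?_
  ring

theorem volume_lt_le (h : FourPointGood C α β G) {η θ α' β' : ℝ} (hθ : 0 < θ)
    (hη : C * η < θ ^ 2) (hα : α ≤ α') (hlt : α' < β') (hβ : β' ≤ β)
    (hsup : ∃ y ∈ Set.Icc α' β', 1 ≤ G y) :
    volume {y ∈ Set.Icc α' β' | G y < η} ≤ ENNReal.ofReal (3 * θ * (β' - α')) := by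
  by_contra! hvol
  have hD : 0 < β' - α' := sub_pos.2 hlt
  rw [mul_assoc] at hvol
  obtain ⟨x₁, m₁, x₂, m₂, x₃, m₃, x₄, m₄, g₁, g₂, g₃⟩ :=
    exists_four_separated (Set.sep_subset _ _) (by positivity) hvol
  obtain ⟨y, hy, hGy⟩ := hsup
  have := h hα hβ (mul_pos hθ hD) m₁.1 m₂.1 m₃.1 m₄.1 g₁ g₂ g₃ m₁.2.le m₂.2.le m₃.2.le m₄.2.le hy
  have e : (β' - α') / (θ * (β' - α')) = θ⁻¹ := by field_simp
  rw [e, inv_pow, ← div_eq_mul_inv] at this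
  have h1 : C * η / θ ^ 2 < 1 := (div_lt_one (by positivity)).2 hη
  linarith

end FourPointGood

theorem volume_le_of_forall_lt_imp_lt {ι : Type*} {G : ι → ℝ → ℝ} {α β c η : ℝ} {E : Set ℝ}
    (hαβ : α < β) (hc : 0 ≤ c) (hE : E ⊆ Set.Icc α β)
    (hcont : ∀ i, ContinuousOn (G i) (Set.Icc α β))
    (hsup : ∀ i, ∃ x ∈ Set.Icc α β, 1 ≤ G i x)
    (hsmall : ∀ x ∈ E, ∃ i, G i x < 1)
    (hgood : ∀ i α' β', α ≤ α' → α' < β' → β' ≤ β → (∃ y ∈ Set.Icc α' β', 1 ≤ G i y) →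
      volume {y ∈ Set.Icc α' β' | G i y < η} ≤ ENNReal.ofReal (c * (β' - α')))
    (hgap : ∀ y ∈ E, ∀ i, G i y < 1 → G i y < η) :
    volume E ≤ ENNReal.ofReal (10 * c * (β - α)) :=
  volume_le_of_forall_family hαβ hc hE hcont hsup hsmall fun α' β' hα hlt hβ h i =>
    (measure_mono (t := {y ∈ Set.Icc α' β' | G i y < η})
      fun y hy => ⟨hy.1.2, hgap y hy.1.1 i hy.2⟩).trans (hgood i α' β' hα hlt hβ (h i))

section PrimitiveVectors

open scoped Matrix

/-- An integer vector whose entries generate the unit ideal. -/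
def IsPrimitiveVec (v : Fin 3 → ℤ) : Prop := ∃ c, c ⬝ᵥ v = 1

namespace IsPrimitiveVec

variable {a v w : Fin 3 → ℤ}

theorem ne_zero (hv : IsPrimitiveVec v) : v ≠ 0 := by
  rintro rfl
  obtain ⟨c, hc⟩ := hv
  simp at hc

theorem exists_smul_of_cross_eq_zero (hv : IsPrimitiveVec v) (h : w ⨯₃ v = 0) :
    ∃ k : ℤ, w = k • v := by
  obtain ⟨c, hc⟩ := hv
  refine ⟨c ⬝ᵥ w, ?_⟩
  have h0 := congrFun h 0
  have h1 := congrFun h 1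
  have h2 := congrFun h 2
  simp [cross_apply, dotProduct, Fin.sum_univ_three] at h0 h1 h2 hc ⊢
  ext i
  fin_cases i <;> simp
  · linear_combination (-w 0) * hc + c 1 * h2 - c 2 * h1
  · linear_combination (-w 1) * hc - c 0 * h2 + c 2 * h0
  · linear_combination (-w 2) * hc + c 0 * h1 - c 1 * h0

theorem exists_cross_eq_smul (ha : IsPrimitiveVec a) (hv : v ⬝ᵥ a = 0) (hw : w ⬝ᵥ a = 0) :
    ∃ k : ℤ, v ⨯₃ w = k • a := by
  refine ha.exists_smul_of_cross_eq_zero ?_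
  simp [dotProduct, Fin.sum_univ_three] at hv hw
  ext i
  fin_cases i <;> simp [cross_apply]
  · linear_combination w 0 * hv - v 0 * hw
  · linear_combination w 1 * hv - v 1 * hw
  · linear_combination w 2 * hv - v 2 * hw

end IsPrimitiveVec

theorem exists_eq_smul_isPrimitiveVec {v : Fin 3 → ℤ} (hv : v ≠ 0) :
    ∃ (d : ℤ) (w : Fin 3 → ℤ), d ≠ 0 ∧ IsPrimitiveVec w ∧ v = d • w := by
  obtain ⟨d, hd⟩ := (IsPrincipalIdealRing.principal (Ideal.span (Set.range v))).principal
  have hdvd : ∀ i, ∃ k, v i = d * k := fun i => by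
    have : v i ∈ Ideal.span (Set.range v) := Ideal.subset_span ⟨i, rfl⟩
    rw [hd] at this
    exact Ideal.mem_span_singleton.1 this
  choose w hw using hdvd
  have hd0 : d ≠ 0 := by
    rintro rfl
    exact hv (funext fun i => by simp [hw i])
  obtain ⟨c, hc⟩ : ∃ c : Fin 3 → ℤ, ∑ i, c i * v i = d := by
    refine Ideal.mem_span_range_iff_exists_fun.1 ?_
    rw [hd]
    exact Ideal.mem_span_singleton_self d
  refine ⟨d, w, hd0, ⟨c, mul_left_cancel₀ hd0 ?_⟩, funext fun i => by simp [hw i]⟩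
  simp only [hw, Fin.sum_univ_three] at hc
  simp only [dotProduct, Fin.sum_univ_three]
  linear_combination hc

section Nondivergence

variable {N : (Fin 3 → ℤ) → ℝ} {v w : Fin 3 → ℤ}

theorem le_of_eq_smul (hN : ∀ v, 0 ≤ N v) (hsmul : ∀ (k : ℤ) v, N (k • v) = |(k : ℝ)| * N v)
    {k : ℤ} (hk : w = k • v) (hw : w ≠ 0) : N v ≤ N w := by
  have hk0 : k ≠ 0 := by
    rintro rfl
    simp [hk] at hw
  have : (1 : ℝ) ≤ |(k : ℝ)| := by exact_mod_cast Int.one_le_abs hk0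
  rw [hk, hsmul]
  exact le_mul_of_one_le_left (hN v) this

/-- A quantitative nondivergence estimate in rank three: `N₁`, `N₂` are norms, depending on a
parameter, on the dual lattices of integer vectors. -/
theorem volume_exists_isPrimitiveVec_lt_le {N₁ N₂ : (Fin 3 → ℤ) → ℝ → ℝ} {α β c ε : ℝ}
    (hαβ : α < β) (hc : 0 ≤ c) (hε : 0 < ε) (hε3 : 3 * ε < 1)
    (hN₁ : ∀ v x, 0 ≤ N₁ v x) (hN₂ : ∀ v x, 0 ≤ N₂ v x)
    (hsmul₁ : ∀ (k : ℤ) v x, N₁ (k • v) x = |(k : ℝ)| * N₁ v x)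
    (hsmul₂ : ∀ (k : ℤ) v x, N₂ (k • v) x = |(k : ℝ)| * N₂ v x)
    (hdot : ∀ v w x, |((v ⬝ᵥ w : ℤ) : ℝ)| ≤ 3 * (N₁ v x * N₂ w x))
    (hcross : ∀ v w x, N₁ (v ⨯₃ w) x ≤ 2 * (N₂ v x * N₂ w x))
    (hcont₁ : ∀ v, ContinuousOn (N₁ v) (Set.Icc α β))
    (hcont₂ : ∀ v, ContinuousOn (N₂ v) (Set.Icc α β))
    (hsup₁ : ∀ v ≠ 0, ∃ x ∈ Set.Icc α β, 1 ≤ N₁ v x)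
    (hsup₂ : ∀ v ≠ 0, ∃ x ∈ Set.Icc α β, 1 ≤ N₂ v x)
    (hgood₁ : ∀ v α' β', α ≤ α' → α' < β' → β' ≤ β → (∃ y ∈ Set.Icc α' β', 1 ≤ N₁ v y) →
      volume {y ∈ Set.Icc α' β' | N₁ v y < 2 * ε} ≤ ENNReal.ofReal (c * (β' - α')))
    (hgood₂ : ∀ v α' β', α ≤ α' → α' < β' → β' ≤ β → (∃ y ∈ Set.Icc α' β', 1 ≤ N₂ v y) →
      volume {y ∈ Set.Icc α' β' | N₂ v y < 2 * ε} ≤ ENNReal.ofReal (c * (β' - α'))) :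
    volume {x ∈ Set.Icc α β | ∃ b, IsPrimitiveVec b ∧ N₂ b x < ε} ≤
      ENNReal.ofReal (110 * c * (β - α)) := by
  have hdot0 : ∀ v w x, N₁ v x < 1 → N₂ w x < ε → v ⬝ᵥ w = 0 := by
    intro v w x h₁ h₂
    have h : N₁ v x * N₂ w x ≤ 1 * ε := mul_le_mul h₁.le h₂.le (hN₂ _ _) zero_le_one
    have : |((v ⬝ᵥ w : ℤ) : ℝ)| < 1 := (hdot v w x).trans_lt (by linarith)
    exact Int.abs_lt_one_iff.1 (by exact_mod_cast this)
  have hcrosslt : ∀ v w x, N₂ v x < ε → N₂ w x < 1 → N₁ (v ⨯₃ w) x < 2 * ε := by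
    intro v w x h₁ h₂
    have h : N₂ v x * N₂ w x ≤ N₂ v x * 1 := mul_le_mul_of_nonneg_left h₂.le (hN₂ _ _)
    linarith [hcross v w x]
  have hne : ∀ b v x, IsPrimitiveVec b → IsPrimitiveVec v → N₂ b x < ε → 2 * ε ≤ N₂ v x →
      b ⨯₃ v ≠ 0 := by
    intro b v x hb hv hbε hvε h0
    obtain ⟨k, hk⟩ := hv.exists_smul_of_cross_eq_zero h0
    have := le_of_eq_smul (N := fun v => N₂ v x) (fun v => hN₂ v x) (fun k v => hsmul₂ k v x)
      hk hb.ne_zero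
    linarith
  have hlt : ∀ a b v x, IsPrimitiveVec a → b ⨯₃ v ≠ 0 → b ⬝ᵥ a = 0 → v ⬝ᵥ a = 0 →
      N₂ b x < ε → N₂ v x < 1 → N₁ a x < 2 * ε := by
    intro a b v x ha h0 hba hva hbε hv1
    obtain ⟨k, hk⟩ := ha.exists_cross_eq_smul hba hva
    exact (le_of_eq_smul (N := fun v => N₁ v x) (fun v => hN₁ v x) (fun k v => hsmul₁ k v x)
      hk h0).trans_lt (hcrosslt b v x hbε hv1)
  rw [show 110 * c = 10 * (c + 10 * c) by ring]
  let V := {v : Fin 3 → ℤ // IsPrimitiveVec v}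
  let G : V ⊕ V → ℝ → ℝ := Sum.elim (fun v => N₁ v) (fun v => N₂ v)
  have hadd : ∀ {D : ℝ} {S : Set ℝ} {T : Set ℝ}, 0 ≤ D → volume S ≤ ENNReal.ofReal (c * D) →
      volume T ≤ ENNReal.ofReal (10 * c * D) →
      volume (S ∪ T) ≤ ENNReal.ofReal ((c + 10 * c) * D) := by
    intro D S T hD hS hT
    rw [add_mul, ENNReal.ofReal_add (by positivity) (by positivity)]
    exact (measure_union_le _ _).trans (add_le_add hS hT)
  refine volume_le_of_forall_family (G := G) hαβ (by positivity) (Set.sep_subset _ _)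
    ?_ ?_ ?_ ?_
  · rintro (v | v)
    exacts [hcont₁ v, hcont₂ v]
  · rintro (v | v)
    exacts [hsup₁ v v.2.ne_zero, hsup₂ v v.2.ne_zero]
  · rintro x ⟨-, b, hb, hbε⟩
    exact ⟨Sum.inr ⟨b, hb⟩, hbε.trans (by linarith)⟩
  intro α' β' hα hα'β' hβ hall i
  have hsub : Set.Icc α' β' ⊆ Set.Icc α β := Set.Icc_subset_Icc hα hβ
  rcases i with ⟨a, ha⟩ | ⟨v, hv⟩
  · let E : Set ℝ := {y ∈ Set.Icc α' β' | 2 * ε ≤ N₁ a y ∧ N₁ a y < 1 ∧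
      ∃ b, IsPrimitiveVec b ∧ N₂ b y < ε}
    have hE : volume E ≤ ENNReal.ofReal (10 * c * (β' - α')) := by
      refine volume_le_of_forall_lt_imp_lt (η := 2 * ε)
        (G := fun w : {w : V // a ⬝ᵥ w.1 = 0} => N₂ w.1.1)
        hα'β' hc (Set.sep_subset _ _) (fun w => (hcont₂ w.1.1).mono hsub)
        (fun w => hall (Sum.inr w.1)) ?_
        (fun w α'' β'' h₁ h₂ h₃ => hgood₂ w.1.1 α'' β'' (hα.trans h₁) h₂ (h₃.trans hβ)) ?_
      · rintro x ⟨-, -, hax, b, hb, hbε⟩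
        exact ⟨⟨⟨b, hb⟩, hdot0 a b x hax hbε⟩, hbε.trans (by linarith)⟩
      · rintro y ⟨-, haε, hay, b, hb, hbε⟩ ⟨⟨v, hv⟩, hav⟩ hvy
        by_contra! hvε
        refine absurd (hlt a b v y ha (hne b v y hb hv hbε hvε) ?_ ?_ hbε hvy) (not_lt.2 haε)
        · rw [dotProduct_comm]; exact hdot0 a b y hay hbε
        · rw [dotProduct_comm]; exact hav
    refine (measure_mono ?_).trans (hadd (sub_pos.2 hα'β').le
      (hgood₁ a α' β' hα hα'β' hβ (hall (Sum.inl ⟨a, ha⟩))) hE)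
    rintro y ⟨⟨⟨-, hb⟩, hy⟩, hay⟩
    rcases lt_or_ge (N₁ a y) (2 * ε) with h | h
    exacts [Or.inl ⟨hy, h⟩, Or.inr ⟨hy, h, hay, hb⟩]
  · let E : Set ℝ := {y ∈ Set.Icc α' β' | 2 * ε ≤ N₂ v y ∧ N₂ v y < 1 ∧
      ∃ b, IsPrimitiveVec b ∧ N₂ b y < ε}
    have hE : volume E ≤ ENNReal.ofReal (10 * c * (β' - α')) := by
      refine volume_le_of_forall_lt_imp_lt (η := 2 * ε)
        (G := fun w : {w : V // v ⬝ᵥ w.1 = 0} => N₁ w.1.1)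
        hα'β' hc (Set.sep_subset _ _) (fun w => (hcont₁ w.1.1).mono hsub)
        (fun w => hall (Sum.inl w.1)) ?_
        (fun w α'' β'' h₁ h₂ h₃ => hgood₁ w.1.1 α'' β'' (hα.trans h₁) h₂ (h₃.trans hβ)) ?_
      · rintro x ⟨-, hvε, hvx, b, hb, hbε⟩
        have h0 := hne b v x hb hv hbε hvε
        obtain ⟨d, a, hd, ha, hda⟩ := exists_eq_smul_isPrimitiveVec h0
        refine ⟨⟨⟨a, ha⟩, ?_⟩, ?_⟩
        · have := dot_cross_self b v
          rw [hda, dotProduct_smul, smul_eq_mul] at this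
          exact (mul_eq_zero.1 this).resolve_left hd
        · have := le_of_eq_smul (N := fun v => N₁ v x) (fun v => hN₁ v x)
            (fun k v => hsmul₁ k v x) hda h0
          have := hcrosslt b v x hbε hvx
          simp only at *
          linarith
      · rintro y ⟨-, hvε, hvy, b, hb, hbε⟩ ⟨⟨a, ha⟩, hva⟩ hay
        refine hlt a b v y ha (hne b v y hb hv hbε hvε) ?_ hva hbε hvy
        rw [dotProduct_comm]; exact hdot0 a b y hay hbε
    refine (measure_mono ?_).trans (hadd (sub_pos.2 hα'β').le
      (hgood₂ v α' β' hα hα'β' hβ (hall (Sum.inr ⟨v, hv⟩))) hE)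
    rintro y ⟨⟨⟨-, hb⟩, hy⟩, hvy⟩
    rcases lt_or_ge (N₂ v y) (2 * ε) with h | h
    exacts [Or.inl ⟨hy, h⟩, Or.inr ⟨hy, h, hvy, hb⟩]

end Nondivergence

theorem FourPointGood.mono {C C' α β : ℝ} {G : ℝ → ℝ} (h : FourPointGood C α β G)
    (hG : ∀ x, 0 ≤ G x) (hC : C ≤ C') : FourPointGood C' α β G := by
  intro α' β' s η x₁ x₂ x₃ x₄ y hα hβ hs m₁ m₂ m₃ m₄ g₁ g₂ g₃ e₁ e₂ e₃ e₄ hy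
  have hη : 0 ≤ η := (hG x₁).trans e₁
  refine (h hα hβ hs m₁ m₂ m₃ m₄ g₁ g₂ g₃ e₁ e₂ e₃ e₄ hy).trans ?_
  gcongr

theorem fourPointGood_const {α β k : ℝ} (hk : 0 ≤ k) : FourPointGood 1 α β fun _ => k := by
  intro α' β' s η x₁ x₂ x₃ x₄ y hα hβ hs m₁ m₂ m₃ m₄ g₁ g₂ g₃ e₁ e₂ e₃ e₄ hy
  have h1 : 1 ≤ (β' - α') / s := (one_le_div hs).2 (by linarith [m₁.1, m₂.2])
  nlinarith [one_le_pow₀ h1 (n := 2)]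

/-- `h` distorts distances by a factor between `m * k` and `M * k` on `s`, for some `k`. -/
def BiLipschitzUpToScale (m M : ℝ) (s : Set ℝ) (h : ℝ → ℝ) : Prop :=
  ∃ k, 0 ≤ k ∧ ∀ x ∈ s, ∀ y ∈ s, m * k * |x - y| ≤ |h x - h y| ∧ |h x - h y| ≤ M * k * |x - y|

namespace BiLipschitzUpToScale

variable {m M α β : ℝ} {h : ℝ → ℝ}

theorem abs_le (hh : BiLipschitzUpToScale m M (Set.Icc α β) h) (hm : 0 < m) (hmM : m ≤ M)
    {s η x₁ x₂ y : ℝ} (hs : 0 < s) (h₁ : x₁ ∈ Set.Icc α β) (h₂ : x₂ ∈ Set.Icc α β)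
    (h₁₂ : x₁ + s ≤ x₂) (e₁ : |h x₁| ≤ η) (e₂ : |h x₂| ≤ η) (hy : y ∈ Set.Icc α β) :
    |h y| ≤ 3 * (M / m) * η * ((β - α) / s) := by
  obtain ⟨k, hk, hh⟩ := hh
  have hη : 0 ≤ η := (abs_nonneg _).trans e₁
  have hD : s ≤ β - α := by linarith [h₁.1, h₂.2]
  have hM : 0 < M := hm.trans_le hmM
  have hks : k ≤ 2 * η / (m * s) := by
    rw [le_div_iff₀ (by positivity)]
    have h1 := (hh x₁ h₁ x₂ h₂).1
    have h2 : s ≤ |x₁ - x₂| := by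
      rw [abs_sub_comm]
      exact (by linarith : s ≤ x₂ - x₁).trans (le_abs_self _)
    have h3 := abs_sub (h x₁) (h x₂)
    have h4 : m * k * s ≤ m * k * |x₁ - x₂| := by gcongr
    linarith
  have hy1 : |y - x₁| ≤ β - α := by
    rw [_root_.abs_le]; constructor <;> linarith [h₁.1, h₁.2, hy.1, hy.2]
  have h5 := (hh y hy x₁ h₁).2
  have h6 : M * k * |y - x₁| ≤ M * (2 * η / (m * s)) * (β - α) := by gcongr
  have h7 := abs_sub_abs_le_abs_sub (h y) (h x₁)
  have h8 : η ≤ M / m * η * ((β - α) / s) := by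
    have a1 : 1 ≤ M / m := (one_le_div hm).2 hmM
    have a2 : 1 ≤ (β - α) / s := (one_le_div hs).2 hD
    have a3 : 1 ≤ M / m * ((β - α) / s) := one_le_mul_of_one_le_of_one_le a1 a2
    nlinarith
  have h9 : M * (2 * η / (m * s)) * (β - α) = 2 * (M / m * η * ((β - α) / s)) := by
    field_simp
  linarith

theorem mono {s t : Set ℝ} (hh : BiLipschitzUpToScale m M s h) (hts : t ⊆ s) :
    BiLipschitzUpToScale m M t h := by
  obtain ⟨k, hk, hh⟩ := hh
  exact ⟨k, hk, fun x hx y hy => hh x (hts hx) y (hts hy)⟩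

theorem fourPointGood (hh : BiLipschitzUpToScale m M (Set.Icc α β) h) (hm : 0 < m)
    (hmM : m ≤ M) : FourPointGood (3 * (M / m)) α β fun x => |h x| := by
  intro α' β' s η x₁ x₂ x₃ x₄ y hα hβ hs m₁ m₂ m₃ m₄ g₁ g₂ g₃ e₁ e₂ e₃ e₄ hy
  have h1 : 1 ≤ (β' - α') / s := (one_le_div hs).2 (by linarith [m₁.1, m₂.2])
  have hη : 0 ≤ η := (abs_nonneg _).trans e₁
  have hM : 0 < M := hm.trans_le hmM
  refine ((hh.mono (Set.Icc_subset_Icc hα hβ)).abs_le hm hmM hs m₁ m₂ g₁ e₁ e₂ hy).trans ?_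
  gcongr
  exact le_self_pow₀ h1 two_ne_zero

end BiLipschitzUpToScale

theorem fourPointGood_of_hasDerivAt {m M m' M' α β : ℝ} {H g h : ℝ → ℝ}
    (hm : 0 < m) (hmM : m ≤ M) (hm' : 0 < m') (hmM' : m' ≤ M')
    (hH : ∀ x ∈ Set.Icc α β, HasDerivAt H (g x * h x) x)
    (hg : ∀ x ∈ Set.Icc α β, m' ≤ |g x| ∧ |g x| ≤ M')
    (hh : BiLipschitzUpToScale m M (Set.Icc α β) h) :
    FourPointGood (7 * (M / m) * (M' / m')) α β fun x => |H x| := by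
  intro α' β' s η x₁ x₂ x₃ x₄ y hα hβ hs m₁ m₂ m₃ m₄ g₁ g₂ g₃ e₁ e₂ e₃ e₄ hy
  have hsub : Set.Icc α' β' ⊆ Set.Icc α β := Set.Icc_subset_Icc hα hβ
  have hη : 0 ≤ η := (abs_nonneg _).trans e₁
  have hM : 0 < M := hm.trans_le hmM
  have hM' : 0 < M' := hm'.trans_le hmM'
  have mvt : ∀ u ∈ Set.Icc α' β', ∀ v ∈ Set.Icc α' β', u + s ≤ v → |H u| ≤ η → |H v| ≤ η →
      ∃ ξ ∈ Set.Icc α' β', u ≤ ξ ∧ ξ ≤ v ∧ |h ξ| ≤ 2 * η / (m' * s) := by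
    intro u hu v hv huv eu ev
    have hI : Set.Icc u v ⊆ Set.Icc α' β' := Set.Icc_subset_Icc hu.1 hv.2
    obtain ⟨ξ, hξ, hξe⟩ := exists_hasDerivAt_eq_slope H (fun x => g x * h x)
      (show u < v by linarith)
      (fun x hx => (hH x (hsub (hI hx))).continuousAt.continuousWithinAt)
      (fun x hx => hH x (hsub (hI (Set.Ioo_subset_Icc_self hx))))
    have hξI := hI (Set.Ioo_subset_Icc_self hξ)
    refine ⟨ξ, hξI, hξ.1.le, hξ.2.le, ?_⟩
    rw [eq_div_iff (by linarith)] at hξe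
    rw [le_div_iff₀ (by positivity)]
    have a1 : |g ξ| * |h ξ| * |v - u| ≤ 2 * η := by
      rw [← abs_mul, ← abs_mul, hξe]
      linarith [abs_sub (H v) (H u)]
    have a2 : s ≤ |v - u| := (by linarith : s ≤ v - u).trans (le_abs_self _)
    calc |h ξ| * (m' * s) = m' * |h ξ| * s := by ring
      _ ≤ |g ξ| * |h ξ| * |v - u| := by gcongr; exact (hg ξ (hsub hξI)).1
      _ ≤ _ := a1
  obtain ⟨ξ, hξ, -, hξ2, eξ⟩ := mvt x₁ m₁ x₂ m₂ g₁ e₁ e₂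
  obtain ⟨ζ, hζ, hζ3, -, eζ⟩ := mvt x₃ m₃ x₄ m₄ g₃ e₃ e₄
  have hD1 : 1 ≤ (β' - α') / s := (one_le_div hs).2 (by linarith [m₁.1, m₂.2])
  have hD0 : 0 ≤ β' - α' := by linarith [m₁.1, m₁.2]
  have hh' : ∀ z ∈ Set.Icc α' β', |h z| ≤ 3 * (M / m) * (2 * η / (m' * s)) * ((β' - α') / s) :=
    fun z hz => (hh.mono hsub).abs_le hm hmM hs hξ hζ (by linarith) eξ eζ hz
  have hdiff : |H y - H x₁| ≤
      M' * (3 * (M / m) * (2 * η / (m' * s)) * ((β' - α') / s)) * |y - x₁| := by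
    have := (convex_Icc α' β').norm_image_sub_le_of_norm_hasDerivWithin_le
      (f := H) (f' := fun x => g x * h x)
      (C := M' * (3 * (M / m) * (2 * η / (m' * s)) * ((β' - α') / s)))
      (fun x hx => (hH x (hsub hx)).hasDerivWithinAt)
      (fun x hx => by
        rw [norm_mul, Real.norm_eq_abs, Real.norm_eq_abs]
        exact mul_le_mul (hg x (hsub hx)).2 (hh' x hx) (abs_nonneg _) hM'.le) m₁ hy
    simpa only [Real.norm_eq_abs] using this
  have hyx : |y - x₁| ≤ β' - α' := by
    rw [abs_le]; constructor <;> linarith [m₁.1, m₁.2, hy.1, hy.2]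
  have hstep : M' * (3 * (M / m) * (2 * η / (m' * s)) * ((β' - α') / s)) * |y - x₁| ≤
      6 * (M / m * (M' / m') * η * ((β' - α') / s) ^ 2) := by
    calc _ ≤ M' * (3 * (M / m) * (2 * η / (m' * s)) * ((β' - α') / s)) * (β' - α') := by gcongr
      _ = _ := by field_simp; ring
  have hη' : η ≤ M / m * (M' / m') * η * ((β' - α') / s) ^ 2 := by
    have a1 : 1 ≤ M / m := (one_le_div hm).2 hmM
    have a2 : 1 ≤ M' / m' := (one_le_div hm').2 hmM'
    have a3 := one_le_mul_of_one_le_of_one_le (one_le_mul_of_one_le_of_one_le a1 a2)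
      (one_le_pow₀ hD1 (n := 2))
    nlinarith
  have h7 := abs_sub_abs_le_abs_sub (H y) (H x₁)
  simp only at e₁ ⊢
  linarith

section Curve

variable (f f₁ : ℝ → ℝ) (X Y : ℝ)

/-- The size at `x` of the integer linear form `v 0 + v 1 * t + v 2 * f t`. -/
noncomputable def formNorm (v : Fin 3 → ℤ) (x : ℝ) : ℝ :=
  max (X * |v 0 + v 1 * x + v 2 * f x|)
    (max ((X * Y)⁻¹ * |v 1 + v 2 * f₁ x|) (Y * |(v 2 : ℝ)|))

/-- The size at `x` of the integer point `v = (q, p₁, p₂)`, read in coordinates adapted to the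
curve `t ↦ (t, f t)`. -/
noncomputable def pointNorm (v : Fin 3 → ℤ) (x : ℝ) : ℝ :=
  max (X⁻¹ * |(v 0 : ℝ)|)
    (max (X * Y * |v 1 - v 0 * x|) (Y⁻¹ * |v 0 * f x + f₁ x * (v 1 - v 0 * x) - v 2|))

variable {f f₁ X Y}

theorem formNorm_nonneg (hY : 0 ≤ Y) (v : Fin 3 → ℤ) (x : ℝ) : 0 ≤ formNorm f f₁ X Y v x :=
  le_max_of_le_right (le_max_of_le_right (by positivity))

theorem pointNorm_nonneg (hX : 0 ≤ X) (v : Fin 3 → ℤ) (x : ℝ) : 0 ≤ pointNorm f f₁ X Y v x :=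
  le_max_of_le_left (by positivity)

theorem formNorm_smul (k : ℤ) (v : Fin 3 → ℤ) (x : ℝ) :
    formNorm f f₁ X Y (k • v) x = |(k : ℝ)| * formNorm f f₁ X Y v x := by
  simp only [formNorm, mul_max_of_nonneg _ _ (abs_nonneg (k : ℝ)), mul_left_comm |(k : ℝ)|,
    ← abs_mul, Pi.smul_apply, smul_eq_mul, Int.cast_mul]
  ring_nf

theorem pointNorm_smul (k : ℤ) (v : Fin 3 → ℤ) (x : ℝ) :
    pointNorm f f₁ X Y (k • v) x = |(k : ℝ)| * pointNorm f f₁ X Y v x := by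
  simp only [pointNorm, mul_max_of_nonneg _ _ (abs_nonneg (k : ℝ)), mul_left_comm |(k : ℝ)|,
    ← abs_mul, Pi.smul_apply, smul_eq_mul, Int.cast_mul]
  ring_nf

theorem formNorm_bounds (hX : 0 < X) (hY : 0 < Y) (v : Fin 3 → ℤ) (x : ℝ) :
    |v 0 + v 1 * x + v 2 * f x| ≤ X⁻¹ * formNorm f f₁ X Y v x ∧
    |v 1 + v 2 * f₁ x| ≤ X * Y * formNorm f f₁ X Y v x ∧
    |(v 2 : ℝ)| ≤ Y⁻¹ * formNorm f f₁ X Y v x := by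
  simp only [← div_eq_inv_mul, le_div_iff₀' hX, le_div_iff₀' hY, ← div_le_iff₀' (mul_pos hX hY)]
  refine ⟨le_max_left _ _, ?_, le_max_of_le_right (le_max_right _ _)⟩
  rw [div_eq_inv_mul]
  exact le_max_of_le_right (le_max_left _ _)

theorem pointNorm_bounds (hX : 0 < X) (hY : 0 < Y) (v : Fin 3 → ℤ) (x : ℝ) :
    |(v 0 : ℝ)| ≤ X * pointNorm f f₁ X Y v x ∧
    |v 1 - v 0 * x| ≤ (X * Y)⁻¹ * pointNorm f f₁ X Y v x ∧
    |v 0 * f x + f₁ x * (v 1 - v 0 * x) - v 2| ≤ Y * pointNorm f f₁ X Y v x := by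
  have hXY := mul_pos hX hY
  rw [← div_eq_inv_mul, le_div_iff₀' hXY, ← div_le_iff₀' hX, ← div_le_iff₀' hY]
  simp only [div_eq_inv_mul]
  exact ⟨le_max_left _ _, le_max_of_le_right (le_max_left _ _),
    le_max_of_le_right (le_max_right _ _)⟩

theorem abs_dotProduct_le_s9 (hX : 0 < X) (hY : 0 < Y) (v w : Fin 3 → ℤ) (x : ℝ) :
    |((v ⬝ᵥ w : ℤ) : ℝ)| ≤ 3 * (formNorm f f₁ X Y v x * pointNorm f f₁ X Y w x) := by
  obtain ⟨a1, a2, a3⟩ := formNorm_bounds (f := f) (f₁ := f₁) hX hY v x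
  obtain ⟨b1, b2, b3⟩ := pointNorm_bounds (f := f) (f₁ := f₁) hX hY w x
  have hA := formNorm_nonneg (f := f) (f₁ := f₁) (X := X) hY.le v x
  have hP := pointNorm_nonneg (f := f) (f₁ := f₁) (Y := Y) hX.le w x
  set A := formNorm f f₁ X Y v x
  set P := pointNorm f f₁ X Y w x
  have key : ((v ⬝ᵥ w : ℤ) : ℝ) = (v 0 + v 1 * x + v 2 * f x) * w 0 +
      (v 1 + v 2 * f₁ x) * (w 1 - w 0 * x) -
      v 2 * (w 0 * f x + f₁ x * (w 1 - w 0 * x) - w 2) := by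
    simp only [dotProduct, Fin.sum_univ_three]
    push_cast
    ring
  have c1 := mul_le_mul a1 b1 (abs_nonneg _) (by positivity)
  have c2 := mul_le_mul a2 b2 (abs_nonneg _) (by positivity)
  have c3 := mul_le_mul a3 b3 (abs_nonneg _) (by positivity)
  rw [← abs_mul] at c1 c2 c3
  have d1 : X⁻¹ * A * (X * P) = A * P := by field_simp
  have d2 : X * Y * A * ((X * Y)⁻¹ * P) = A * P := by field_simp
  have d3 : Y⁻¹ * A * (Y * P) = A * P := by field_simp
  rw [key]
  refine (abs_sub _ _).trans ?_
  linarith [abs_add_le ((v 0 + v 1 * x + v 2 * f x) * w 0) ((v 1 + v 2 * f₁ x) * (w 1 - w 0 * x))]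

theorem formNorm_cross_le (hX : 0 < X) (hY : 0 < Y) (v w : Fin 3 → ℤ) (x : ℝ) :
    formNorm f f₁ X Y (v ⨯₃ w) x ≤
      2 * (pointNorm f f₁ X Y v x * pointNorm f f₁ X Y w x) := by
  obtain ⟨a1, a2, a3⟩ := pointNorm_bounds (f := f) (f₁ := f₁) hX hY v x
  obtain ⟨b1, b2, b3⟩ := pointNorm_bounds (f := f) (f₁ := f₁) hX hY w x
  have hA := pointNorm_nonneg (f := f) (f₁ := f₁) (Y := Y) hX.le v x
  have hP := pointNorm_nonneg (f := f) (f₁ := f₁) (Y := Y) hX.le w x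
  set A := pointNorm f f₁ X Y v x
  set P := pointNorm f f₁ X Y w x
  have aux : ∀ {p q r s a b c d : ℝ}, |p| ≤ a → |q| ≤ b → |r| ≤ c → |s| ≤ d →
      |p * q - r * s| ≤ a * b + c * d := by
    intro p q r s a b c d hp hq hr hs
    refine (abs_sub _ _).trans ?_
    rw [abs_mul, abs_mul]
    exact add_le_add (mul_le_mul hp hq (abs_nonneg _) ((abs_nonneg _).trans hp))
      (mul_le_mul hr hs (abs_nonneg _) ((abs_nonneg _).trans hr))
  refine max_le ?_ (max_le ?_ ?_)
  · have e : ((v ⨯₃ w) 0 : ℝ) + (v ⨯₃ w) 1 * x + (v ⨯₃ w) 2 * f x =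
        (w 1 - w 0 * x) * (v 0 * f x + f₁ x * (v 1 - v 0 * x) - v 2) -
        (v 1 - v 0 * x) * (w 0 * f x + f₁ x * (w 1 - w 0 * x) - w 2) := by
      simp [cross_apply]; ring
    rw [e, ← le_div_iff₀' hX]
    refine (aux b2 a3 a2 b3).trans_eq ?_
    field_simp; ring
  · have e : ((v ⨯₃ w) 1 : ℝ) + (v ⨯₃ w) 2 * f₁ x =
        v 0 * (w 0 * f x + f₁ x * (w 1 - w 0 * x) - w 2) -
        w 0 * (v 0 * f x + f₁ x * (v 1 - v 0 * x) - v 2) := by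
      simp [cross_apply]; ring
    rw [e, ← div_eq_inv_mul, div_le_iff₀' (by positivity)]
    refine (aux a1 b3 b1 a3).trans_eq ?_
    ring
  · have e : ((v ⨯₃ w) 2 : ℝ) = v 0 * (w 1 - w 0 * x) - w 0 * (v 1 - v 0 * x) := by
      simp [cross_apply]; ring
    rw [e, ← le_div_iff₀' hY]
    refine (aux a1 b2 b1 a2).trans_eq ?_
    field_simp; ring

end Curve

section Curve

variable {f f₁ f₂ : ℝ → ℝ} {X Y m M α β : ℝ}

theorem slope_bounds_of_hasDerivAt (hf₁ : ∀ x ∈ Set.Icc α β, HasDerivAt f₁ (f₂ x) x)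
    (hf₂ : ∀ x ∈ Set.Icc α β, m ≤ |f₂ x| ∧ |f₂ x| ≤ M) {x y : ℝ}
    (hx : x ∈ Set.Icc α β) (hy : y ∈ Set.Icc α β) :
    m * |x - y| ≤ |f₁ x - f₁ y| ∧ |f₁ x - f₁ y| ≤ M * |x - y| := by
  wlog hxy : x < y generalizing x y
  · rcases (not_lt.1 hxy).eq_or_lt with rfl | h
    · simp
    · have := this hy hx h
      rwa [abs_sub_comm y, abs_sub_comm (f₁ y)] at this
  have hI : Set.Icc x y ⊆ Set.Icc α β := Set.Icc_subset_Icc hx.1 hy.2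
  obtain ⟨ξ, hξ, e⟩ := exists_hasDerivAt_eq_slope f₁ f₂ hxy
    (fun z hz => (hf₁ z (hI hz)).continuousAt.continuousWithinAt)
    (fun z hz => hf₁ z (hI (Set.Ioo_subset_Icc_self hz)))
  rw [eq_div_iff (sub_pos.2 hxy).ne'] at e
  obtain ⟨h1, h2⟩ := hf₂ ξ (hI (Set.Ioo_subset_Icc_self hξ))
  rw [abs_sub_comm (f₁ x), ← e, abs_mul, abs_sub_comm x]
  exact ⟨by gcongr, by gcongr⟩

theorem fourPointGood_formNorm (hX : 0 < X) (hY : 0 < Y) (hm : 0 < m) (hmM : m ≤ M)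
    (hf : ∀ x ∈ Set.Icc α β, HasDerivAt f (f₁ x) x)
    (hf₁ : ∀ x ∈ Set.Icc α β, HasDerivAt f₁ (f₂ x) x)
    (hf₂ : ∀ x ∈ Set.Icc α β, m ≤ |f₂ x| ∧ |f₂ x| ≤ M) (v : Fin 3 → ℤ) :
    FourPointGood (7 * (M / m)) α β (formNorm f f₁ X Y v) := by
  have h1 : 1 ≤ M / m := (one_le_div hm).2 hmM
  have hbi : BiLipschitzUpToScale m M (Set.Icc α β) fun x => (v 1 : ℝ) + v 2 * f₁ x := by
    refine ⟨|(v 2 : ℝ)|, abs_nonneg _, fun x hx y hy => ?_⟩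
    obtain ⟨a, b⟩ := slope_bounds_of_hasDerivAt hf₁ hf₂ hx hy
    rw [show (v 1 : ℝ) + v 2 * f₁ x - (v 1 + v 2 * f₁ y) = v 2 * (f₁ x - f₁ y) by ring, abs_mul,
      mul_right_comm, mul_comm, mul_right_comm M, mul_comm (M * _)]
    exact ⟨by gcongr, by gcongr⟩
  refine .max (.const_mul ?_ hX) (.max (.const_mul ?_ (by positivity)) (.const_mul ?_ hY))
  · have := fourPointGood_of_hasDerivAt (H := fun x => (v 0 : ℝ) + v 1 * x + v 2 * f x)
      (g := fun _ => 1) (m' := 1) (M' := 1) hm hmM one_pos le_rfl (fun x hx => ?_)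
      (fun x _ => by simp) hbi
    · simpa using this
    · have := (((hasDerivAt_id x).const_mul (v 1 : ℝ)).const_add (v 0 : ℝ)).add
        ((hf x hx).const_mul (v 2 : ℝ))
      exact this.congr_deriv (by simp)
  · exact (hbi.fourPointGood hm hmM).mono (fun _ => abs_nonneg _) (by linarith)
  · exact (fourPointGood_const (abs_nonneg _)).mono (fun _ => abs_nonneg _) (by linarith)

theorem fourPointGood_pointNorm (hX : 0 < X) (hY : 0 < Y) (hm : 0 < m) (hmM : m ≤ M)
    (hf : ∀ x ∈ Set.Icc α β, HasDerivAt f (f₁ x) x)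
    (hf₁ : ∀ x ∈ Set.Icc α β, HasDerivAt f₁ (f₂ x) x)
    (hf₂ : ∀ x ∈ Set.Icc α β, m ≤ |f₂ x| ∧ |f₂ x| ≤ M) (v : Fin 3 → ℤ) :
    FourPointGood (7 * (M / m)) α β (pointNorm f f₁ X Y v) := by
  have h1 : 1 ≤ M / m := (one_le_div hm).2 hmM
  have hbi : BiLipschitzUpToScale 1 1 (Set.Icc α β) fun x => (v 1 : ℝ) - v 0 * x := by
    refine ⟨|(v 0 : ℝ)|, abs_nonneg _, fun x hx y hy => ?_⟩
    rw [show (v 1 : ℝ) - v 0 * x - (v 1 - v 0 * y) = -(v 0 * (x - y)) by ring, abs_neg, abs_mul,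
      one_mul]
    exact ⟨le_rfl, le_rfl⟩
  refine .max (.const_mul ?_ (by positivity))
    (.max (.const_mul ?_ (by positivity)) (.const_mul ?_ (by positivity)))
  · exact (fourPointGood_const (abs_nonneg _)).mono (fun _ => abs_nonneg _) (by linarith)
  · exact (hbi.fourPointGood one_pos le_rfl).mono (fun _ => abs_nonneg _) (by linarith)
  · have := fourPointGood_of_hasDerivAt
      (H := fun x => (v 0 : ℝ) * f x + f₁ x * (v 1 - v 0 * x) - v 2)
      (g := f₂) one_pos le_rfl hm hmM (fun x hx => ?_) hf₂ hbi
    · simpa using this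
    · have := (((hf x hx).const_mul (v 0 : ℝ)).add ((hf₁ x hx).mul
        (((hasDerivAt_id x).const_mul (v 0 : ℝ)).const_sub (v 1 : ℝ)))).sub_const (v 2 : ℝ)
      exact this.congr_deriv (by simp; ring)

theorem continuousOn_formNorm (hf : ContinuousOn f (Set.Icc α β))
    (hf₁ : ContinuousOn f₁ (Set.Icc α β)) (v : Fin 3 → ℤ) :
    ContinuousOn (formNorm f f₁ X Y v) (Set.Icc α β) := by
  unfold formNorm
  fun_prop

theorem continuousOn_pointNorm (hf : ContinuousOn f (Set.Icc α β))
    (hf₁ : ContinuousOn f₁ (Set.Icc α β)) (v : Fin 3 → ℤ) :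
    ContinuousOn (pointNorm f f₁ X Y v) (Set.Icc α β) := by
  unfold pointNorm
  fun_prop

theorem int_eq_zero_of_abs_cast_lt_one {k : ℤ} (h : |(k : ℝ)| < 1) : k = 0 :=
  Int.abs_lt_one_iff.1 (by exact_mod_cast h)

theorem vec_eq_zero {v : Fin 3 → ℤ} (h₀ : v 0 = 0) (h₁ : v 1 = 0) (h₂ : v 2 = 0) : v = 0 := by
  ext i
  fin_cases i <;> assumption

theorem exists_one_le_formNorm (hαβ : α < β) (hX1 : 1 ≤ X) (hXD : 2 ≤ X * (β - α))
    (hXf : 4 ≤ X * |f α - 2 * f ((α + β) / 2) + f β|) {v : Fin 3 → ℤ} (hv : v ≠ 0) :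
    ∃ x ∈ Set.Icc α β, 1 ≤ formNorm f f₁ X Y v x := by
  by_contra! h
  have hX : 0 < X := by linarith
  have hF : ∀ x ∈ Set.Icc α β, X * |v 0 + v 1 * x + v 2 * f x| < 1 := fun x hx =>
    (le_max_left _ _).trans_lt (h x hx)
  have hα := hF α ⟨le_rfl, hαβ.le⟩
  have hβ := hF β ⟨hαβ.le, le_rfl⟩
  have hmid := hF ((α + β) / 2) ⟨by linarith, by linarith⟩
  rw [← abs_of_pos hX, ← abs_mul, abs_lt] at hα hβ hmid
  have h2 : v 2 = 0 := by
    refine int_eq_zero_of_abs_cast_lt_one ?_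
    have : X * |f α - 2 * f ((α + β) / 2) + f β| * |(v 2 : ℝ)| < 4 := by
      rw [← abs_of_pos hX, ← abs_mul, ← abs_mul, abs_lt]
      constructor <;> nlinarith
    nlinarith [abs_nonneg (v 2 : ℝ)]
  simp only [h2, Int.cast_zero, zero_mul, add_zero] at hα hβ
  have h1 : v 1 = 0 := by
    refine int_eq_zero_of_abs_cast_lt_one ?_
    have : X * (β - α) * |(v 1 : ℝ)| < 2 := by
      rw [← abs_of_pos (show 0 < X * (β - α) by linarith), ← abs_mul, abs_lt]
      constructor <;> nlinarith
    nlinarith [abs_nonneg (v 1 : ℝ)]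
  simp only [h1, Int.cast_zero, zero_mul, add_zero] at hα
  refine hv (vec_eq_zero (int_eq_zero_of_abs_cast_lt_one ?_) h1 h2)
  rw [← abs_lt, abs_mul, abs_of_pos hX] at hα
  nlinarith [abs_nonneg (v 0 : ℝ)]

theorem exists_one_le_pointNorm (hαβ : α < β) (hY : 0 < Y) (hY1 : Y ≤ 1) (hXY1 : 1 ≤ X * Y)
    (hXYD : 2 ≤ X * Y * (β - α)) {v : Fin 3 → ℤ} (hv : v ≠ 0) :
    ∃ x ∈ Set.Icc α β, 1 ≤ pointNorm f f₁ X Y v x := by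
  by_contra! h
  have hXY : 0 < X * Y := by linarith
  have hα' := h α ⟨le_rfl, hαβ.le⟩
  have hβ' := h β ⟨hαβ.le, le_rfl⟩
  simp only [pointNorm, max_lt_iff] at hα' hβ'
  obtain ⟨-, hα, hL⟩ := hα'
  have hβ := hβ'.2.1
  rw [← abs_of_pos hXY, ← abs_mul, abs_lt] at hα hβ
  have h0 : v 0 = 0 := by
    refine int_eq_zero_of_abs_cast_lt_one ?_
    have : X * Y * (β - α) * |(v 0 : ℝ)| < 2 := by
      rw [← abs_of_pos (show 0 < X * Y * (β - α) by linarith), ← abs_mul, abs_lt]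
      constructor <;> nlinarith
    nlinarith [abs_nonneg (v 0 : ℝ)]
  simp only [h0, Int.cast_zero, zero_mul, sub_zero, zero_add] at hα hL
  have h1 : v 1 = 0 := by
    refine int_eq_zero_of_abs_cast_lt_one ?_
    rw [← abs_lt, abs_mul, abs_of_pos hXY] at hα
    nlinarith [abs_nonneg (v 1 : ℝ)]
  simp only [h1, Int.cast_zero, mul_zero, zero_sub, abs_neg] at hL
  refine hv (vec_eq_zero h0 h1 (int_eq_zero_of_abs_cast_lt_one ?_))
  rw [inv_mul_lt_iff₀ hY] at hL
  linarith

theorem second_difference_ne_zero (hαβ : α < β) (hm : 0 < m)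
    (hf : ∀ x ∈ Set.Icc α β, HasDerivAt f (f₁ x) x)
    (hf₁ : ∀ x ∈ Set.Icc α β, HasDerivAt f₁ (f₂ x) x)
    (hf₂ : ∀ x ∈ Set.Icc α β, m ≤ |f₂ x| ∧ |f₂ x| ≤ M) :
    f α - 2 * f ((α + β) / 2) + f β ≠ 0 := by
  intro h0
  have mvt : ∀ x y, x < y → α ≤ x → y ≤ β → ∃ ξ ∈ Set.Ioo x y, f₁ ξ * (y - x) = f y - f x := by
    intro x y hxy hx hy
    have hI : Set.Icc x y ⊆ Set.Icc α β := Set.Icc_subset_Icc hx hy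
    obtain ⟨ξ, hξ, e⟩ := exists_hasDerivAt_eq_slope f f₁ hxy
      (fun z hz => (hf z (hI hz)).continuousAt.continuousWithinAt)
      (fun z hz => hf z (hI (Set.Ioo_subset_Icc_self hz)))
    exact ⟨ξ, hξ, by rwa [eq_div_iff (sub_pos.2 hxy).ne'] at e⟩
  obtain ⟨ξ, hξ, eξ⟩ := mvt α ((α + β) / 2) (by linarith) le_rfl (by linarith)
  obtain ⟨ζ, hζ, eζ⟩ := mvt ((α + β) / 2) β (by linarith) (by linarith) le_rfl
  have he : f₁ ζ = f₁ ξ := by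
    have : (f₁ ζ - f₁ ξ) * (β - α) = 0 := by linear_combination 2 * eζ - 2 * eξ + 2 * h0
    rcases mul_eq_zero.1 this with h | h <;> linarith
  have hb := (slope_bounds_of_hasDerivAt hf₁ hf₂ (x := ζ) (y := ξ)
    ⟨by linarith [hζ.1], hζ.2.le⟩ ⟨hξ.1.le, by linarith [hξ.2]⟩).1
  rw [he, sub_self, abs_zero] at hb
  have : 0 < |ζ - ξ| := abs_pos.2 (by linarith [hξ.2, hζ.1])
  nlinarith

theorem volume_exists_pointNorm_lt_le {ε θ : ℝ} (hαβ : α < β) (hm : 0 < m) (hmM : m ≤ M)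
    (hf : ∀ x ∈ Set.Icc α β, HasDerivAt f (f₁ x) x)
    (hf₁ : ∀ x ∈ Set.Icc α β, HasDerivAt f₁ (f₂ x) x)
    (hf₂ : ∀ x ∈ Set.Icc α β, m ≤ |f₂ x| ∧ |f₂ x| ≤ M)
    (hε : 0 < ε) (hε3 : 3 * ε < 1) (hθ : 0 < θ) (hεθ : 7 * (M / m) * (2 * ε) < θ ^ 2)
    (hY : 0 < Y) (hX1 : 1 ≤ X) (hXD : 2 ≤ X * (β - α))
    (hXf : 4 ≤ X * |f α - 2 * f ((α + β) / 2) + f β|)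
    (hY1 : Y ≤ 1) (hXY1 : 1 ≤ X * Y) (hXYD : 2 ≤ X * Y * (β - α)) :
    volume {x ∈ Set.Icc α β | ∃ b, IsPrimitiveVec b ∧ pointNorm f f₁ X Y b x < ε} ≤
      ENNReal.ofReal (330 * θ * (β - α)) := by
  have hX : 0 < X := by linarith
  have hcf : ContinuousOn f (Set.Icc α β) := fun x hx => (hf x hx).continuousAt.continuousWithinAt
  have hcf₁ : ContinuousOn f₁ (Set.Icc α β) :=
    fun x hx => (hf₁ x hx).continuousAt.continuousWithinAt
  rw [show 330 * θ * (β - α) = 110 * (3 * θ) * (β - α) by ring]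
  exact volume_exists_isPrimitiveVec_lt_le (N₁ := formNorm f f₁ X Y) hαβ (by positivity) hε hε3
    (formNorm_nonneg hY.le) (pointNorm_nonneg hX.le) formNorm_smul pointNorm_smul
    (abs_dotProduct_le_s9 hX hY) (formNorm_cross_le hX hY) (continuousOn_formNorm hcf hcf₁)
    (continuousOn_pointNorm hcf hcf₁) (fun v hv => exists_one_le_formNorm hαβ hX1 hXD hXf hv)
    (fun v hv => exists_one_le_pointNorm hαβ hY hY1 hXY1 hXYD hv)
    (fun v α' β' => (fourPointGood_formNorm hX hY hm hmM hf hf₁ hf₂ v).volume_lt_le hθ hεθ)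
    (fun v α' β' => (fourPointGood_pointNorm hX hY hm hmM hf hf₁ hf₂ v).volume_lt_le hθ hεθ)

end Curve

/-- Minkowski's linear forms theorem for the forms attached to a point of the curve. -/
theorem exists_ne_zero_abs_le {A B C : ℝ} (hA : 0 < A) (hB : 0 < B) (hABC : 1 < A * B * C)
    (x y z : ℝ) : ∃ v : Fin 3 → ℤ, v ≠ 0 ∧ |(v 0 : ℝ)| ≤ A ∧ |v 1 - v 0 * x| ≤ B ∧
      |v 0 * y + z * (v 1 - v 0 * x) - v 2| ≤ C := by
  have hC : 0 < C := by
    by_contra! h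
    have := mul_nonpos_of_nonneg_of_nonpos (mul_pos hA hB).le h
    linarith
  let T : Matrix (Fin 3) (Fin 3) ℝ := !![1, 0, 0; -x, 1, 0; y - z * x, z, -1]
  let φ := Matrix.toLin' T
  have hdet : LinearMap.det φ = -1 := by
    simp [φ, T, Matrix.det_fin_three]
  let r : Fin 3 → ℝ := ![A, B, C]
  let s : Set (Fin 3 → ℝ) := φ ⁻¹' Set.Icc (-r) r
  let b := Pi.basisFun ℝ (Fin 3)
  have hvol : volume (ZSpan.fundamentalDomain b) * 2 ^ Module.finrank ℝ (Fin 3 → ℝ) <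
      volume s := by
    have h1 : volume s = ENNReal.ofReal (8 * (A * B * C)) := by
      rw [Measure.addHaar_preimage_linearMap _ (by rw [hdet]; norm_num), hdet,
        Real.volume_Icc_pi, Fin.prod_univ_three, ← ENNReal.ofReal_mul (by simp [r]; positivity),
        ← ENNReal.ofReal_mul (by simp [r]; positivity), ← ENNReal.ofReal_mul (by positivity)]
      congr 1
      simp [r]
      ring
    have h2 : volume (ZSpan.fundamentalDomain b) = 1 := by
      simp [b, ZSpan.fundamentalDomain_pi_basisFun, volume_pi_pi]
    rw [h1, h2, one_mul, Module.finrank_fin_fun,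
      show (2 : ENNReal) ^ 3 = ENNReal.ofReal 8 by norm_num]
    exact (ENNReal.ofReal_lt_ofReal_iff (by positivity)).2 (by linarith)
  have hsymm : ∀ w ∈ s, -w ∈ s := by
    intro w hw
    simp only [s, Set.mem_preimage, map_neg, Set.mem_Icc] at hw ⊢
    exact ⟨neg_le_neg hw.2, neg_le.1 hw.1⟩
  have hconv : Convex ℝ s := (convex_Icc _ _).linear_preimage φ
  have : Countable (Submodule.span ℤ (Set.range b)).toAddSubgroup :=
    inferInstanceAs (Countable (Submodule.span ℤ (Set.range b)))
  obtain ⟨⟨w, hw⟩, hw0, hws⟩ := exists_ne_zero_mem_lattice_of_measure_mul_two_pow_lt_measure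
    (ZSpan.isAddFundamentalDomain' b volume) hsymm hconv hvol
  have hwi : ∀ i, ∃ k : ℤ, (k : ℝ) = w i := by
    have : w ∈ Submodule.span ℤ (Set.range b) := hw
    rw [b.mem_span_iff_repr_mem ℤ w] at this
    intro i
    simpa [b] using this i
  choose v hv using hwi
  have hws' : φ w ∈ Set.Icc (-r) r := hws
  have e0 : φ w 0 = w 0 := by simp [φ, T, Matrix.vecHead, Matrix.vecTail]
  have e1 : φ w 1 = w 1 - w 0 * x := by
    simp [φ, T, Matrix.mulVec, dotProduct, Fin.sum_univ_three]; ring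
  have e2 : φ w 2 = w 0 * y + z * (w 1 - w 0 * x) - w 2 := by
    simp [φ, T, Matrix.mulVec, dotProduct, Fin.sum_univ_three]; ring
  have hb : ∀ i, |φ w i| ≤ r i := fun i => abs_le.2 ⟨hws'.1 i, hws'.2 i⟩
  refine ⟨v, ?_, ?_, ?_, ?_⟩
  · rintro rfl
    refine hw0 (Subtype.ext (funext fun i => ?_))
    simpa using (hv i).symm
  · simpa [hv, e0, r] using hb 0
  · simpa [hv, e1, r] using hb 1
  · simpa [hv, e2, r] using hb 2

theorem abs_sub_sub_mul_le_of_hasDerivAt {f f₁ f₂ : ℝ → ℝ} {M x z : ℝ} {s : Set ℝ}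
    (hs : s.OrdConnected) (hf : ∀ x ∈ s, HasDerivAt f (f₁ x) x)
    (hf₁ : ∀ x ∈ s, HasDerivAt f₁ (f₂ x) x) (hf₂ : ∀ x ∈ s, |f₂ x| ≤ M)
    (hx : x ∈ s) (hz : z ∈ s) :
    |f z - f x - f₁ x * (z - x)| ≤ M * |z - x| ^ 2 := by
  have hM : 0 ≤ M := (abs_nonneg _).trans (hf₂ x hx)
  have hI : Set.uIcc x z ⊆ s := hs.uIcc_subset hx hz
  have hslope : ∀ y ∈ Set.uIcc x z, ‖f₁ y - f₁ x‖ ≤ M * |z - x| := fun y hy =>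
    ((convex_uIcc x z).norm_image_sub_le_of_norm_hasDerivWithin_le
      (fun w hw => (hf₁ w (hI hw)).hasDerivWithinAt) (fun w hw => hf₂ w (hI hw))
      Set.left_mem_uIcc hy).trans
      (mul_le_mul_of_nonneg_left (Set.abs_sub_left_of_mem_uIcc hy) hM)
  have := (convex_uIcc x z).norm_image_sub_le_of_norm_hasDerivWithin_le
    (f := fun y => f y - f₁ x * y) (f' := fun y => f₁ y - f₁ x)
    (fun w hw => ((hf w (hI hw)).sub (((hasDerivAt_id w).const_mul (f₁ x)).congr_deriv
      (mul_one _))).hasDerivWithinAt) hslope Set.left_mem_uIcc Set.right_mem_uIcc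
  rw [Real.norm_eq_abs, Real.norm_eq_abs] at this
  calc |f z - f x - f₁ x * (z - x)| = |f z - f₁ x * z - (f x - f₁ x * x)| := by ring_nf
    _ ≤ M * |z - x| * |z - x| := this
    _ = M * |z - x| ^ 2 := by ring

theorem den2_pos (r : ℚ × ℚ) : 0 < den2 r :=
  Nat.lcm_pos r.1.pos r.2.pos

theorem den2_le_natAbs {q : ℤ} (hq : q ≠ 0) (p₁ p₂ : ℤ) :
    den2 ((p₁ : ℚ) / q, (p₂ : ℚ) / q) ≤ q.natAbs := by
  have h : ∀ p : ℤ, ((p : ℚ) / q).den ∣ q.natAbs := fun p =>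
    Int.natCast_dvd.1 (by rw [← Rat.divInt_eq_div]; exact Rat.den_dvd p q)
  exact Nat.le_of_dvd (Int.natAbs_pos.2 hq) (Nat.lcm_dvd (h p₁) (h p₂))

theorem exists_rat_near_of_le_pointNorm {f f₁ f₂ ψ : ℝ → ℝ} {a b M ε T R δ x : ℝ}
    (hf : ∀ x ∈ Set.Ioo a b, HasDerivAt f (f₁ x) x)
    (hf₁ : ∀ x ∈ Set.Ioo a b, HasDerivAt f₁ (f₂ x) x)
    (hf₂ : ∀ x ∈ Set.Ioo a b, |f₂ x| ≤ M) (hψ : IsApproxFun ψ) (hε : 0 < ε) (hT : 0 < T)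
    (hM : 75 / 2 * M < (ε * (T * ψ T)) ^ 3) (hδ : δ = 15 / 2 / ε ^ 3 / (T ^ 2 * ψ T))
    (hδR : δ < R) (hδa : a < x - δ) (hδb : x + δ < b)
    (hx : ∀ w, IsPrimitiveVec w → ε ≤ pointNorm f f₁ (ε ^ 2 * T / 3) (ψ T / ε) w x) :
    ∃ r : ℚ × ℚ, (den2 r : ℝ) ≤ T ∧ |f r.1 - r.2| < ψ (den2 r) / den2 r ∧ |x - r.1| < R := by
  have hψT : 0 < ψ T := hψ.2 T hT
  have hδ0 : 0 < δ := by rw [hδ]; positivity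
  have hxI : x ∈ Set.Ioo a b := ⟨by linarith, by linarith⟩
  obtain ⟨v, hv, hA, hB, hC⟩ := exists_ne_zero_abs_le (A := T) (B := 5 / 2 / (T * ψ T))
    (C := ψ T / 2) hT (by positivity) (by field_simp; norm_num) x (f x) (f₁ x)
  obtain ⟨d, w, hd, hw, rfl⟩ := exists_eq_smul_isPrimitiveVec hv
  have hd1 : (1 : ℝ) ≤ |(d : ℝ)| := by exact_mod_cast Int.one_le_abs hd
  have key : ∀ {y c : ℝ}, |d * y| ≤ c → |y| ≤ c := fun {y c} h => by
    rw [abs_mul] at h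
    nlinarith [abs_nonneg y]
  simp only [Pi.smul_apply, smul_eq_mul, Int.cast_mul] at hA hB hC
  have hA' := key hA
  have hB' : |w 1 - w 0 * x| ≤ 5 / 2 / (T * ψ T) := key (by convert hB using 2; ring)
  have hC' : |w 0 * f x + f₁ x * (w 1 - w 0 * x) - w 2| ≤ ψ T / 2 :=
    key (by convert hC using 2; ring)
  have hq : ε ^ 3 * T / 3 ≤ |(w 0 : ℝ)| := by
    have h := hx w hw
    rw [pointNorm, le_max_iff, le_max_iff] at h
    rcases h with h | h | h
    · rw [le_inv_mul_iff₀ (by positivity)] at h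
      linarith
    · have : ε ^ 2 * T / 3 * (ψ T / ε) * |w 1 - w 0 * x| ≤
          ε ^ 2 * T / 3 * (ψ T / ε) * (5 / 2 / (T * ψ T)) := by gcongr
      have e : ε ^ 2 * T / 3 * (ψ T / ε) * (5 / 2 / (T * ψ T)) = 5 / 6 * ε := by
        field_simp; norm_num
      linarith
    · rw [le_inv_mul_iff₀ (by positivity), div_mul_cancel₀ _ hε.ne'] at h
      linarith
  have hq0 : (0 : ℝ) < |(w 0 : ℝ)| := lt_of_lt_of_le (by positivity) hq
  have hw0 : (w 0 : ℝ) ≠ 0 := abs_pos.1 hq0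
  set z : ℝ := w 1 / w 0 with hz
  have hzx : |z - x| = |w 1 - w 0 * x| / |(w 0 : ℝ)| := by
    rw [← abs_div, hz]; congr 1; field_simp
  have hzδ : |z - x| ≤ δ := by
    calc |z - x| ≤ 5 / 2 / (T * ψ T) / (ε ^ 3 * T / 3) := by rw [hzx]; gcongr
      _ = δ := by rw [hδ]; field_simp; norm_num
  have hzI : z ∈ Set.Ioo a b := by
    obtain ⟨h1, h2⟩ := abs_le.1 hzδ
    exact ⟨by linarith, by linarith⟩
  have htaylor := abs_sub_sub_mul_le_of_hasDerivAt Set.ordConnected_Ioo hf hf₁ hf₂ hxI hzI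
  have hM0 : 0 ≤ M := (abs_nonneg _).trans (hf₂ x hxI)
  have hclose : |f z - w 2 / w 0| < ψ T / |(w 0 : ℝ)| := by
    have e : f z - w 2 / w 0 = f z - f x - f₁ x * (z - x) +
        (w 0 * f x + f₁ x * (w 1 - w 0 * x) - w 2) / w 0 := by
      rw [hz]; field_simp; ring
    have h1 : M * |z - x| ^ 2 ≤ M * δ * (5 / 2 / (T * ψ T)) / |(w 0 : ℝ)| := by
      calc M * |z - x| ^ 2 = M * |z - x| * (|w 1 - w 0 * x| / |(w 0 : ℝ)|) := by
            rw [← hzx]; ring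
        _ ≤ M * δ * (5 / 2 / (T * ψ T) / |(w 0 : ℝ)|) := by gcongr
        _ = _ := by ring
    have h2 : M * δ * (5 / 2 / (T * ψ T)) < ψ T / 2 := by
      have : M * δ * (5 / 2 / (T * ψ T)) =
          75 / 2 * M / (ε * (T * ψ T)) ^ 3 * (ψ T / 2) := by
        rw [hδ]; field_simp; ring
      rw [this]
      exact mul_lt_of_lt_one_left (by positivity) ((div_lt_one (by positivity)).2 hM)
    calc |f z - w 2 / w 0| ≤ M * |z - x| ^ 2 +
          |w 0 * f x + f₁ x * (w 1 - w 0 * x) - w 2| / |(w 0 : ℝ)| := by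
          rw [e, ← abs_div]
          exact (abs_add_le _ _).trans (by gcongr)
      _ < ψ T / 2 / |(w 0 : ℝ)| + ψ T / 2 / |(w 0 : ℝ)| :=
          add_lt_add_of_lt_of_le (h1.trans_lt (by gcongr)) (by gcongr)
      _ = ψ T / |(w 0 : ℝ)| := by ring
  let r : ℚ × ℚ := ((w 1 : ℚ) / w 0, (w 2 : ℚ) / w 0)
  have hr1 : (r.1 : ℝ) = z := by simp [r, hz]
  have hr2 : (r.2 : ℝ) = w 2 / w 0 := by simp [r]
  have hden : (den2 r : ℝ) ≤ |(w 0 : ℝ)| := by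
    rw [← Int.cast_abs, Int.abs_eq_natAbs, Int.cast_natCast]
    exact Nat.cast_le.2 (den2_le_natAbs (Int.cast_ne_zero.1 hw0) (w 1) (w 2))
  have hden0 : (0 : ℝ) < den2 r := by exact_mod_cast den2_pos r
  refine ⟨r, hden.trans hA', ?_, ?_⟩
  · rw [hr1, hr2]
    refine hclose.trans_le ?_
    have : ψ T ≤ ψ (den2 r) := hψ.1 _ _ hden0 (hden.trans hA')
    exact div_le_div₀ (hψ.2 _ hden0).le this hden0 hden
  · rw [hr1, abs_sub_comm]
    exact hzδ.trans_lt hδR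

/-- The points of `I` that lie within `R` of the first coordinate of a rational point of
denominator at most `T` close to the graph of `f`. -/
def nearRatSet (f ψ : ℝ → ℝ) (T R : ℝ) (I : Set ℝ) : Set ℝ :=
  ⋃ r ∈ {r : ℚ × ℚ | (den2 r : ℝ) ≤ T ∧ |f (r.1 : ℝ) - (r.2 : ℝ)| < ψ (den2 r) / (den2 r)},
    Metric.ball ((r.1 : ℝ)) R ∩ I

theorem eventually_volume_le_nearRatSet {f f₁ f₂ ψ u : ℝ → ℝ} {a b α β m M : ℝ} (hm : 0 < m)
    (hf : ∀ x ∈ Set.Ioo a b, HasDerivAt f (f₁ x) x)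
    (hf₁ : ∀ x ∈ Set.Ioo a b, HasDerivAt f₁ (f₂ x) x)
    (hf₂ : ∀ x ∈ Set.Ioo a b, m ≤ |f₂ x| ∧ |f₂ x| ≤ M) (hψ : IsApproxFun ψ)
    (hψ0 : Tendsto ψ atTop (nhds 0)) (htψ : Tendsto (fun t : ℝ => t * ψ t) atTop atTop)
    (hu : Tendsto u atTop atTop) (haα : a < α) (hαβ : α < β) (hβb : β < b) {I : Set ℝ}
    (hI : Set.Icc α β ⊆ I) :
    ∀ᶠ T in atTop, ENNReal.ofReal (3 / 4 * (β - α)) ≤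
      volume (nearRatSet f ψ T (u T / (T ^ 2 * ψ T)) I) := by
  have hJ : Set.Icc α β ⊆ Set.Ioo a b := Set.Icc_subset_Ioo haα hβb
  have hmM : m ≤ M :=
    (hf₂ α (hJ (Set.left_mem_Icc.2 hαβ.le))).1.trans (hf₂ α (hJ (Set.left_mem_Icc.2 hαβ.le))).2
  have hM : 0 < M := hm.trans_le hmM
  have h1 : 1 ≤ M / m := (one_le_div hm).2 hmM
  obtain ⟨ε, hε, hεθ, hε3⟩ : ∃ ε : ℝ, 0 < ε ∧ 7 * (M / m) * (2 * ε) < (1 / 1320) ^ 2 ∧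
      3 * ε < 1 := by
    refine ⟨(1 / 1320) ^ 2 / (28 * (M / m)), by positivity, ?_, ?_⟩
    · have : 7 * (M / m) * (2 * ((1 / 1320) ^ 2 / (28 * (M / m)))) = (1 / 1320) ^ 2 / 2 := by
        field_simp; norm_num
      rw [this]; norm_num
    · rw [← mul_div_assoc, div_lt_one (by positivity)]
      linarith
  have hS : 0 < |f α - 2 * f ((α + β) / 2) + f β| :=
    abs_pos.2 (second_difference_ne_zero hαβ hm (fun x hx => hf x (hJ hx))
      (fun x hx => hf₁ x (hJ hx)) (fun x hx => hf₂ x (hJ hx)))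
  have hX : Tendsto (fun T : ℝ => ε ^ 2 * T / 3) atTop atTop :=
    (tendsto_id.const_mul_atTop (by positivity)).atTop_div_const (by norm_num)
  have hXY : Tendsto (fun T : ℝ => ε ^ 2 * T / 3 * (ψ T / ε)) atTop atTop := by
    refine (htψ.const_mul_atTop (r := ε / 3) (by positivity)).congr fun T => ?_
    field_simp
  have hP : Tendsto (fun T : ℝ => 15 / 2 / ε ^ 3 / (T ^ 2 * ψ T)) atTop (nhds 0) := by
    refine Tendsto.div_atTop tendsto_const_nhds ((tendsto_id.atTop_mul_atTop₀ htψ).congr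
      fun T => ?_)
    simp only [id]; ring
  have hcube : Tendsto (fun T : ℝ => (ε * (T * ψ T)) ^ 3) atTop atTop :=
    (tendsto_pow_atTop (by norm_num)).comp (htψ.const_mul_atTop hε)
  filter_upwards [eventually_gt_atTop 0, hX.eventually_ge_atTop 1,
    (hX.atTop_mul_const (sub_pos.2 hαβ)).eventually_ge_atTop 2,
    (hX.atTop_mul_const hS).eventually_ge_atTop 4, hψ0.eventually_le_const hε,
    hXY.eventually_ge_atTop 1, (hXY.atTop_mul_const (sub_pos.2 hαβ)).eventually_ge_atTop 2,
    hP.eventually_lt_const (sub_pos.2 haα), hP.eventually_lt_const (sub_pos.2 hβb),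
    hcube.eventually_gt_atTop (75 / 2 * M), hu.eventually_gt_atTop (15 / 2 / ε ^ 3)]
    with T hT hX1 hXD hXf hψε hXY1 hXYD hδa hδb hcubeT huT
  have hψT : 0 < ψ T := hψ.2 T hT
  have hbad := volume_exists_pointNorm_lt_le hαβ hm hmM (fun x hx => hf x (hJ hx))
    (fun x hx => hf₁ x (hJ hx)) (fun x hx => hf₂ x (hJ hx)) hε hε3 (by norm_num) hεθ
    (div_pos hψT hε) hX1 hXD hXf ((div_le_one hε).2 hψε) hXY1 hXYD
  set E := {x ∈ Set.Icc α β | ∃ b, IsPrimitiveVec b ∧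
    pointNorm f f₁ (ε ^ 2 * T / 3) (ψ T / ε) b x < ε}
  have hcover : Set.Icc α β ⊆ nearRatSet f ψ T (u T / (T ^ 2 * ψ T)) I ∪ E := by
    intro x hx
    by_cases hxE : x ∈ E
    · exact Or.inr hxE
    have hgood : ∀ w, IsPrimitiveVec w → ε ≤ pointNorm f f₁ (ε ^ 2 * T / 3) (ψ T / ε) w x :=
      fun w hw => not_lt.1 fun h => hxE ⟨hx, w, hw, h⟩
    obtain ⟨r, hr1, hr2, hr3⟩ := exists_rat_near_of_le_pointNorm (R := u T / (T ^ 2 * ψ T)) hf hf₁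
      (fun x hx => (hf₂ x hx).2) hψ hε hT hcubeT rfl (by gcongr) (by linarith [hx.1])
      (by linarith [hx.2]) hgood
    exact Or.inl (Set.mem_iUnion₂.2 ⟨r, ⟨hr1, hr2⟩, hr3, hI hx⟩)
  have hvol := (measure_mono hcover).trans (measure_union_le (μ := volume) _ _)
  rw [Real.volume_Icc] at hvol
  refine (ENNReal.add_le_add_iff_right (a := ENNReal.ofReal (1 / 4 * (β - α)))
    ENNReal.ofReal_ne_top).1 ?_
  rw [← ENNReal.ofReal_add (by linarith) (by linarith)]
  calc ENNReal.ofReal (3 / 4 * (β - α) + 1 / 4 * (β - α)) = ENNReal.ofReal (β - α) := by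
        congr 1; ring
    _ ≤ _ := hvol
    _ ≤ _ := by
      gcongr
      exact hbad.trans_eq (by congr 1; ring)

theorem exists_Icc_subset_of_ordConnected {I : Set ℝ} {a b : ℝ} (hI : I ⊆ Set.Ioo a b)
    (hIc : I.OrdConnected) (hvol : volume I ≠ 0) :
    ∃ α β, a < α ∧ α < β ∧ β < b ∧ Set.Icc α β ⊆ I ∧
      volume I ≤ ENNReal.ofReal (4 / 3 * (β - α)) := by
  have hne : I.Nonempty := nonempty_of_measure_ne_zero hvol
  have hbb : BddBelow I := bddBelow_Ioo.mono hI
  have hba : BddAbove I := bddAbove_Ioo.mono hI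
  have hsub : I ⊆ Set.Icc (sInf I) (sSup I) := fun x hx => ⟨csInf_le hbb hx, le_csSup hba hx⟩
  have hlen : volume I ≤ ENNReal.ofReal (sSup I - sInf I) :=
    (measure_mono hsub).trans_eq Real.volume_Icc
  have hD : 0 < sSup I - sInf I := by
    by_contra! h
    exact hvol (le_antisymm (hlen.trans_eq (ENNReal.ofReal_of_nonpos h)) bot_le)
  obtain ⟨y, hy, hyα⟩ := exists_lt_of_csInf_lt hne
    (show sInf I < sInf I + (sSup I - sInf I) / 8 by linarith)
  obtain ⟨z, hz, hzβ⟩ := exists_lt_of_lt_csSup hne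
    (show sSup I - (sSup I - sInf I) / 8 < sSup I by linarith)
  refine ⟨sInf I + (sSup I - sInf I) / 8, sSup I - (sSup I - sInf I) / 8, ?_, by linarith, ?_,
    (Set.Icc_subset_Icc hyα.le hzβ.le).trans (hIc.out hy hz), ?_⟩
  · linarith [(hI hy).1]
  · linarith [(hI hz).2]
  · exact hlen.trans_eq (by congr 1; ring)

end PrimitiveVectors

theorem local_ubiquity_near_curve
    (a b : ℝ) (hab : a < b)
    (f : ℝ → ℝ) (hf : ContDiffOn ℝ 3 f (Set.Ioo a b))
    (c₁ c₂ : ℝ) (hc₁ : 0 < c₁)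
    (hfb : ∀ x ∈ Set.Ioo a b,
      c₁ ≤ |iteratedDerivWithin 2 f (Set.Ioo a b) x| ∧
      |iteratedDerivWithin 2 f (Set.Ioo a b) x| ≤ c₂)
    (ψ : ℝ → ℝ) (hψ : IsApproxFun ψ)
    (hψ0 : Tendsto ψ atTop (nhds 0))
    (htψ : Tendsto (fun t : ℝ => t * ψ t) atTop atTop)
    (u : ℝ → ℝ) (hu : Tendsto u atTop atTop)
    (ρ : ℝ → ℝ) (hρ : ρ = fun t => u t / (t ^ 2 * ψ t)) :
    ∃ κ > (0 : ℝ), ∀ I ⊆ Set.Ioo a b, I.OrdConnected →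
      ENNReal.ofReal κ * volume I ≤
        liminf (fun t : ℕ =>
          volume (⋃ r ∈ {r : ℚ × ℚ | (den2 r : ℝ) ≤ 2 ^ t ∧
              |f (r.1 : ℝ) - (r.2 : ℝ)| < ψ (den2 r) / (den2 r)},
            Metric.ball ((r.1 : ℝ)) (ρ (2 ^ t)) ∩ I)) atTop := by
  have hf1 : ∀ x ∈ Set.Ioo a b, HasDerivAt f (deriv f x) x := fun x hx =>
    ((hf.differentiableOn (by norm_num)).differentiableAt (isOpen_Ioo.mem_nhds hx)).hasDerivAt
  have hf2 : ∀ x ∈ Set.Ioo a b, HasDerivAt (deriv f) (deriv (deriv f) x) x := fun x hx =>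
    (((hf.deriv_of_isOpen (m := 1) isOpen_Ioo (by norm_num)).differentiableOn
      (by norm_num)).differentiableAt (isOpen_Ioo.mem_nhds hx)).hasDerivAt
  have hf3 : ∀ x ∈ Set.Ioo a b, c₁ ≤ |deriv (deriv f) x| ∧ |deriv (deriv f) x| ≤ c₂ := by
    intro x hx
    have := hfb x hx
    rwa [iteratedDerivWithin_of_isOpen isOpen_Ioo hx, iteratedDeriv_succ, iteratedDeriv_one] at this
  refine ⟨1 / 2, by norm_num, fun I hI hIc => ?_⟩
  rcases eq_or_ne (volume I) 0 with h0 | h0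
  · simp [h0]
  obtain ⟨α, β, haα, hαβ, hβb, hJ, hvol⟩ := exists_Icc_subset_of_ordConnected hI hIc h0
  have hev := (tendsto_pow_atTop_atTop_of_one_lt (one_lt_two : (1 : ℝ) < 2)).eventually
    (eventually_volume_le_nearRatSet hc₁ hf1 hf2 hf3 hψ hψ0 htψ hu haα hαβ hβb hJ)
  refine le_liminf_of_le (by isBoundedDefault) (hev.mono fun t ht => ?_)
  subst hρ
  refine le_trans ?_ ht
  calc ENNReal.ofReal (1 / 2) * volume I ≤
        ENNReal.ofReal (1 / 2) * ENNReal.ofReal (4 / 3 * (β - α)) := by gcongr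
    _ = ENNReal.ofReal (1 / 2 * (4 / 3 * (β - α))) := (ENNReal.ofReal_mul (by norm_num)).symm
    _ ≤ ENNReal.ofReal (3 / 4 * (β - α)) := ENNReal.ofReal_le_ofReal (by linarith)
end
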